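/- arXiv:1107.4713 — 2 statements merged into one kernel-verified Lean document; each statement's English description precedes it below -/
import Mathlib

section
/- Let F be an algebraically closed field of characteristic zero, G a group, and let A and B be finite-dimensional G-simple G-graded F-algebras. Then A and B are G-graded isomorphic if and only if Id_G(A) = Id_G(B). -/
open scoped DirectSum

/-- A multiplicatively-indexed internal grading of an `F`-algebra `A` by the group `G`:
`A` is the internal direct sum of the subspaces `𝒜 g` and `𝒜 g * 𝒜 h ⊆ 𝒜 (g*h)`. -/
structure IsGAlgGrading (F : Type*) [Field F] {G : Type*} [Group G] {A : Type*} [Ring A]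
    [Algebra F A] [DecidableEq G] (𝒜 : G → Submodule F A) : Prop where
  isInternal : DirectSum.IsInternal 𝒜
  mul_mem : ∀ ⦃g h : G⦄ ⦃a b : A⦄, a ∈ 𝒜 g → b ∈ 𝒜 h → a * b ∈ 𝒜 (g * h)
/-- A `G`-graded algebra is `G`-simple if it is nonzero and its only two-sided ideals
generated by homogeneous elements are `⊥` and `⊤`. -/
def IsGSimpleAlg (F : Type*) [Field F] {G : Type*} [Group G] {A : Type*} [Ring A]
    [Algebra F A] (𝒜 : G → Submodule F A) : Prop :=
  (∃ a : A, a ≠ 0) ∧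
  ∀ I : TwoSidedIdeal A,
    (∀ a ∈ I, a ∈ Submodule.span F {x : A | (∃ g, x ∈ 𝒜 g) ∧ x ∈ I}) →
    I = ⊥ ∨ I = ⊤
/-- `p` is a `G`-graded identity of the graded algebra `(A, 𝒜)`: `p` vanishes under any
substitution sending the variable `(i, g)` (the `i`-th variable of degree `g`) to an
element of `𝒜 g`. -/
def IsGradedIdentity (F : Type*) [Field F] {G : Type*} [Group G] {A : Type*} [Ring A]
    [Algebra F A] (𝒜 : G → Submodule F A) (p : FreeAlgebra F (ℕ × G)) : Prop :=
  ∀ v : ℕ × G → A, (∀ (i : ℕ) (g : G), v (i, g) ∈ 𝒜 g) →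
    FreeAlgebra.lift F v p = 0

section Sandwich

open scoped TensorProduct
variable (F : Type*) [Field F]

/-- The linear map sending `a ⊗ b` to the operator `z ↦ a * z * b`. -/
noncomputable def sandwich (A : Type*) [Ring A] [Algebra F A] : A ⊗[F] A →ₗ[F] Module.End F A :=
  TensorProduct.lift (LinearMap.mk₂ F
    (fun a b => LinearMap.mulLeft F a ∘ₗ LinearMap.mulRight F b)
    (by intros; ext; simp [add_mul]) (by intros; ext; simp)
    (by intros; ext; simp [mul_add]) (by intros; ext; simp))

variable {F} {A B : Type*} [Ring A] [Algebra F A] [Ring B] [Algebra F B]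

@[simp]
theorem sandwich_tmul (a b z : A) : sandwich F A (a ⊗ₜ b) z = a * z * b := by
  simp [sandwich, mul_assoc]

theorem map_sandwich (φ : A →ₐ[F] B) (t : A ⊗[F] A) (z : A) :
    φ (sandwich F A t z) = sandwich F B (TensorProduct.map φ.toLinearMap φ.toLinearMap t) (φ z) := by
  induction t with
  | zero => simp
  | tmul a b => simp
  | add s t hs ht => simp [hs, ht]

theorem exists_sandwich_mul (s t : A ⊗[F] A) :
    ∃ r, sandwich F A r = sandwich F A s ∘ₗ sandwich F A t := by
  induction s with
  | zero => exact ⟨0, by simp⟩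
  | add s s' hs hs' =>
    obtain ⟨r, hr⟩ := hs
    obtain ⟨r', hr'⟩ := hs'
    exact ⟨r + r', by rw [map_add, map_add, hr, hr', LinearMap.add_comp]⟩
  | tmul a b =>
    induction t with
    | zero => exact ⟨0, by simp⟩
    | add s s' hs hs' =>
      obtain ⟨r, hr⟩ := hs
      obtain ⟨r', hr'⟩ := hs'
      exact ⟨r + r', by rw [map_add, map_add, hr, hr', LinearMap.comp_add]⟩
    | tmul c d => exact ⟨(a * c) ⊗ₜ (d * b), by ext; simp [mul_assoc]⟩

/-- The noncommutative Capelli expression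
`∑ σ, sign σ • ∏ k, sandwich (t k) (x (σ k))`, alternating in `x`. -/
noncomputable def capelli {n : ℕ} (t : Fin n → A ⊗[F] A) : A [⋀^Fin n]→ₗ[F] A :=
  MultilinearMap.alternatization
    ((MultilinearMap.mkPiAlgebraFin F n A).compLinearMap fun k => sandwich F A (t k))

theorem map_capelli (φ : A →ₐ[F] B) {n : ℕ} (t : Fin n → A ⊗[F] A) (x : Fin n → A) :
    φ (capelli t x) =
      capelli (fun k => TensorProduct.map φ.toLinearMap φ.toLinearMap (t k)) (fun k => φ (x k)) := by
  simp [capelli, MultilinearMap.alternatization_apply, map_sum, map_list_prod, List.map_ofFn,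
    Function.comp_def, map_sandwich, Units.smul_def]

theorem capelli_eq_one {n : ℕ} (t : Fin n → A ⊗[F] A) (x : Fin n → A)
    (h : ∀ k l, sandwich F A (t k) (x l) = if l = k then 1 else 0) : capelli t x = 1 := by
  rw [capelli, MultilinearMap.alternatization_apply, Finset.sum_eq_single 1]
  · simp [h]
  · intro σ _ hσ
    obtain ⟨k, hk⟩ : ∃ k, σ k ≠ k := by
      by_contra! hc
      exact hσ (Equiv.ext hc)
    have : (0 : A) ∈ List.ofFn fun k => sandwich F A (t k) (x (σ k)) :=
      List.mem_ofFn.2 ⟨k, by simp [h, hk]⟩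
    simp only [MultilinearMap.domDomCongr_apply, MultilinearMap.compLinearMap_apply,
      MultilinearMap.mkPiAlgebraFin_apply]
    rw [List.prod_eq_zero this, smul_zero]
  · simp

theorem AlternatingMap.map_update_sum_smul {M N ι : Type*} [AddCommGroup M] [Module F M]
    [AddCommGroup N] [Module F N] [Fintype ι] [DecidableEq ι] (f : M [⋀^ι]→ₗ[F] N) (x : ι → M)
    (k : ι) (c : ι → F) : f (Function.update x k (∑ l, c l • x l)) = c k • f x := by
  rw [f.map_update_sum, Finset.sum_eq_single k]
  · rw [f.map_update_smul, Function.update_eq_self]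
  · intro l _ hl
    rw [f.map_update_smul, f.map_update_self _ hl.symm, smul_zero]
  · simp

end Sandwich

section Nullstellensatz

variable {F : Type*} [Field F] [IsAlgClosed F]

theorem nonempty_algHom_of_finiteType (Q : Type*) [CommRing Q] [Algebra F Q]
    [Algebra.FiniteType F Q] [Nontrivial Q] : Nonempty (Q →ₐ[F] F) := by
  obtain ⟨m, hm⟩ := Ideal.exists_maximal Q
  let := Ideal.Quotient.field m
  have : Algebra.FiniteType F (Q ⧸ m) :=
    Algebra.FiniteType.of_surjective (Ideal.Quotient.mkₐ F m) Ideal.Quotient.mk_surjective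
  have := finite_of_finite_type_of_isJacobsonRing F (Q ⧸ m)
  let e : F ≃ₐ[F] (Q ⧸ m) := AlgEquiv.ofBijective (Algebra.ofId F (Q ⧸ m))
    IsAlgClosed.algebraMap_bijective_of_isIntegral
  exact ⟨e.symm.toAlgHom.comp (Ideal.Quotient.mkₐ F m)⟩

theorem exists_algHom_apply_ne_zero {P : Type*} [CommRing P] [IsDomain P] [Algebra F P]
    [Algebra.FiniteType F P] {x : P} (hx : x ≠ 0) : ∃ p : P →ₐ[F] F, p x ≠ 0 := by
  have : Algebra.FiniteType P (Localization.Away x) :=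
    IsLocalization.finiteType_of_monoid_fg (Submonoid.powers x) _
  have : Algebra.FiniteType F (Localization.Away x) := Algebra.FiniteType.trans (S := P) ‹_› ‹_›
  have : Nontrivial (Localization.Away x) := (IsLocalization.injective (Localization.Away x)
    (powers_le_nonZeroDivisors_of_noZeroDivisors hx)).nontrivial
  obtain ⟨p⟩ := nonempty_algHom_of_finiteType (F := F) (Localization.Away x)
  refine ⟨p.comp (IsScalarTower.toAlgHom F P _), ?_⟩
  exact (IsUnit.map p (IsLocalization.Away.algebraMap_isUnit x)).ne_zero

open scoped TensorProduct in
theorem exists_algHom_comp_eq_of_ker_eq {R P Q : Type*} [CommRing R] [Algebra F R]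
    [CommRing P] [IsDomain P] [Algebra F P] [Algebra.FiniteType F P]
    [CommRing Q] [IsDomain Q] [Algebra F Q] [Algebra.FiniteType F Q]
    (α : R →ₐ[F] P) (β : R →ₐ[F] Q) (h : ∀ x, α x = 0 ↔ β x = 0) :
    ∃ (p : P →ₐ[F] F) (q : Q →ₐ[F] F), p.comp α = q.comp β := by
  let I := RingHom.ker α
  let D := R ⧸ I
  let α' : D →ₐ[F] P := Ideal.Quotient.liftₐ I α fun a ha => ha
  let β' : D →ₐ[F] Q := Ideal.Quotient.liftₐ I β fun a ha => (h a).1 ha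
  let := α'.toRingHom.toAlgebra
  let := β'.toRingHom.toAlgebra
  have hα : Function.Injective (algebraMap D P) :=
    (injective_iff_map_eq_zero α').2 fun a ha => by
      obtain ⟨a, rfl⟩ := Ideal.Quotient.mk_surjective a
      exact Ideal.Quotient.eq_zero_iff_mem.2 ha
  have hβ : Function.Injective (algebraMap D Q) :=
    (injective_iff_map_eq_zero β').2 fun a ha => by
      obtain ⟨a, rfl⟩ := Ideal.Quotient.mk_surjective a
      exact Ideal.Quotient.eq_zero_iff_mem.2 ((h a).2 ha)
  have : IsScalarTower F D P := .of_algebraMap_eq fun x => (α'.commutes x).symm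
  have : IsScalarTower F D Q := .of_algebraMap_eq fun x => (β'.commutes x).symm
  have : Nontrivial (P ⊗[D] Q) :=
    Algebra.TensorProduct.nontrivial_of_algebraMap_injective_of_isDomain D P Q hα hβ
  have : Algebra.FiniteType D Q := Algebra.FiniteType.of_restrictScalars_finiteType F D Q
  have : Algebra.FiniteType P (P ⊗[D] Q) := inferInstance
  have : Algebra.FiniteType F (P ⊗[D] Q) := Algebra.FiniteType.trans (S := P) ‹_› ‹_›
  obtain ⟨t⟩ := nonempty_algHom_of_finiteType (F := F) (P ⊗[D] Q)
  refine ⟨t.comp (IsScalarTower.toAlgHom F P (P ⊗[D] Q)),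
    t.comp ((Algebra.TensorProduct.includeRight (R := D) (A := P) (B := Q)).restrictScalars F), ?_⟩
  ext x
  change t (α x ⊗ₜ 1) = t (1 ⊗ₜ β x)
  have : (algebraMap D P (Ideal.Quotient.mk I x) ⊗ₜ[D] (1 : Q)) =
      (1 : P) ⊗ₜ[D] algebraMap D Q (Ideal.Quotient.mk I x) := by
    simp only [Algebra.algebraMap_eq_smul_one, TensorProduct.smul_tmul]
  exact congrArg t this

end Nullstellensatz

section Density

open scoped TensorProduct

variable {F : Type*} [Field F] {G : Type*} [DecidableEq G]
  {A : Type*} [Ring A] [Algebra F A] {𝒜 : G → Submodule F A}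

/-- The projection of a graded vector space onto its component of degree `g`. -/
noncomputable def gradedProj (h : DirectSum.IsInternal 𝒜) (g : G) : A →ₗ[F] A :=
  letI := h.chooseDecomposition
  (𝒜 g).subtype ∘ₗ DirectSum.component F G (fun i => 𝒜 i) g ∘ₗ
    (DirectSum.decomposeLinearEquiv 𝒜).toLinearMap

theorem gradedProj_mem (h : DirectSum.IsInternal 𝒜) (g : G) (a : A) : gradedProj h g a ∈ 𝒜 g :=
  Subtype.prop _

theorem gradedProj_of_mem (h : DirectSum.IsInternal 𝒜) {g : G} {a : A} (ha : a ∈ 𝒜 g) :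
    gradedProj h g a = a :=
  letI := h.chooseDecomposition
  DirectSum.decompose_of_mem_same 𝒜 ha

theorem gradedProj_of_mem_ne (h : DirectSum.IsInternal 𝒜) {g k : G} {a : A} (ha : a ∈ 𝒜 g)
    (hgk : g ≠ k) : gradedProj h k a = 0 :=
  letI := h.chooseDecomposition
  DirectSum.decompose_of_mem_ne 𝒜 ha hgk

theorem finite_ne_bot [FiniteDimensional F A] (h : DirectSum.IsInternal 𝒜) :
    {g | 𝒜 g ≠ ⊥}.Finite :=
  WellFoundedGT.finite_ne_bot_of_iSupIndep h.submodule_iSupIndep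

@[elab_as_elim]
theorem graded_induction (h : DirectSum.IsInternal 𝒜) {motive : A → Prop} (zero : motive 0)
    (hom : ∀ g, ∀ a ∈ 𝒜 g, motive a) (add : ∀ a b, motive a → motive b → motive (a + b)) (a : A) :
    motive a :=
  Submodule.iSup_induction 𝒜 (motive := motive) (h.submodule_iSup_eq_top ▸ Submodule.mem_top)
    hom zero add

theorem sum_gradedProj [FiniteDimensional F A] (h : DirectSum.IsInternal 𝒜) (a : A) :
    ∑ g ∈ (finite_ne_bot h).toFinset, gradedProj h g a = a := by
  induction a using graded_induction h with
  | zero => simp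
  | add a b ha hb => simp only [map_add, Finset.sum_add_distrib, ha, hb]
  | hom g a ha =>
    rw [Finset.sum_eq_single g, gradedProj_of_mem h ha]
    · exact fun k _ hk => gradedProj_of_mem_ne h ha hk.symm
    · intro hg
      simp only [Set.Finite.mem_toFinset, Set.mem_ofPred_eq, not_not] at hg
      rw [hg, Submodule.mem_bot] at ha
      simp [ha]

/-- The operators all of whose homogeneous components are given by two-sided multiplications. -/
noncomputable def multiplicationAlgebra [FiniteDimensional F A] (h : DirectSum.IsInternal 𝒜) :
    Subalgebra F (Module.End F A) where
  carrier := {m | ∀ g k, ∃ t, ∀ z ∈ 𝒜 g, gradedProj h k (m z) = sandwich F A t z}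
  mul_mem' {m m'} hm hm' g k := by
    choose s hs using fun l => hm l k
    choose t ht using hm' g
    choose r hr using fun l => exists_sandwich_mul (s l) (t l)
    refine ⟨∑ l ∈ (finite_ne_bot h).toFinset, r l, fun z hz => ?_⟩
    rw [Module.End.mul_apply, ← sum_gradedProj h (m' z)]
    simp only [map_sum, LinearMap.sum_apply, hr, LinearMap.comp_apply]
    exact Finset.sum_congr rfl fun l _ => by
      rw [hs l _ (gradedProj_mem h l _), ht l z hz]
  add_mem' {m m'} hm hm' g k := by
    obtain ⟨s, hs⟩ := hm g k
    obtain ⟨t, ht⟩ := hm' g k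
    exact ⟨s + t, fun z hz => by simp [hs z hz, ht z hz]⟩
  algebraMap_mem' c g k := by
    by_cases hgk : g = k
    · subst hgk
      exact ⟨c • 1 ⊗ₜ 1, fun z hz => by
        simp [Module.algebraMap_end_apply, gradedProj_of_mem h hz]⟩
    · exact ⟨0, fun z hz => by
        simp [Module.algebraMap_end_apply, gradedProj_of_mem_ne h hz hgk]⟩

theorem gradedProj_mem_multiplicationAlgebra [FiniteDimensional F A] (h : DirectSum.IsInternal 𝒜)
    (l : G) : gradedProj h l ∈ multiplicationAlgebra h := by
  intro g k
  by_cases hgl : g = l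
  · by_cases hlk : l = k
    · subst hgl hlk
      exact ⟨1 ⊗ₜ 1, fun z hz => by simp [gradedProj_of_mem h hz]⟩
    · exact ⟨0, fun z _ => by simp [gradedProj_of_mem_ne h (gradedProj_mem h l z) hlk]⟩
  · exact ⟨0, fun z hz => by simp [gradedProj_of_mem_ne h hz hgl]⟩

variable [Group G]

theorem mulLeft_mem_multiplicationAlgebra [FiniteDimensional F A] (h : IsGAlgGrading F 𝒜)
    (u : A) : LinearMap.mulLeft F u ∈ multiplicationAlgebra h.isInternal := by
  induction u using graded_induction h.isInternal with
  | zero => simp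
  | add a b ha hb =>
    have : LinearMap.mulLeft F (a + b) = LinearMap.mulLeft F a + LinearMap.mulLeft F b := by
      ext z
      simp [add_mul]
    exact this ▸ add_mem ha hb
  | hom l a ha =>
    intro g k
    by_cases hk : l * g = k
    · subst hk
      exact ⟨a ⊗ₜ 1, fun z hz => by simp [gradedProj_of_mem h.isInternal (h.mul_mem ha hz)]⟩
    · exact ⟨0, fun z hz => by simp [gradedProj_of_mem_ne h.isInternal (h.mul_mem ha hz) hk]⟩

theorem mulRight_mem_multiplicationAlgebra [FiniteDimensional F A] (h : IsGAlgGrading F 𝒜)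
    (u : A) : LinearMap.mulRight F u ∈ multiplicationAlgebra h.isInternal := by
  induction u using graded_induction h.isInternal with
  | zero => simp
  | add a b ha hb =>
    have : LinearMap.mulRight F (a + b) = LinearMap.mulRight F a + LinearMap.mulRight F b := by
      ext z
      simp [mul_add]
    exact this ▸ add_mem ha hb
  | hom l a ha =>
    intro g k
    by_cases hk : g * l = k
    · subst hk
      exact ⟨1 ⊗ₜ a, fun z hz => by simp [gradedProj_of_mem h.isInternal (h.mul_mem hz ha)]⟩
    · exact ⟨0, fun z hz => by simp [gradedProj_of_mem_ne h.isInternal (h.mul_mem hz ha) hk]⟩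

theorem isSimpleModule_multiplicationAlgebra [FiniteDimensional F A] (h : IsGAlgGrading F 𝒜)
    (hs : IsGSimpleAlg F 𝒜) : IsSimpleModule (multiplicationAlgebra h.isInternal) A := by
  have : Nontrivial A := let ⟨a, ha⟩ := hs.1; ⟨a, 0, ha⟩
  refine { eq_bot_or_eq_top := fun W => ?_ }
  have hL (u z : A) (hz : z ∈ W) : u * z ∈ W :=
    W.smul_mem ⟨_, mulLeft_mem_multiplicationAlgebra h u⟩ hz
  have hR (u z : A) (hz : z ∈ W) : z * u ∈ W :=
    W.smul_mem ⟨_, mulRight_mem_multiplicationAlgebra h u⟩ hz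
  have hP (g : G) (z : A) (hz : z ∈ W) : gradedProj h.isInternal g z ∈ W :=
    W.smul_mem ⟨_, gradedProj_mem_multiplicationAlgebra h.isInternal g⟩ hz
  let I : TwoSidedIdeal A := TwoSidedIdeal.mk' (W : Set A) W.zero_mem W.add_mem
    (fun hx => by simpa using hL (-1) _ hx)
    (hL _ _) (hR _ _)
  have hI (x : A) : x ∈ I ↔ x ∈ W := TwoSidedIdeal.mem_mk' ..
  refine (hs.2 I fun a ha => ?_).imp (fun e => ?_) fun e => ?_
  · rw [← sum_gradedProj h.isInternal a]
    exact Submodule.sum_mem _ fun g _ => Submodule.subset_span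
      ⟨⟨g, gradedProj_mem _ g a⟩, (hI _).2 (hP g a ((hI a).1 ha))⟩
  · ext x
    rw [← hI, e, TwoSidedIdeal.mem_bot, Submodule.mem_bot]
  · ext x
    simp [← hI, e]

theorem multiplicationAlgebra_eq_top [IsAlgClosed F] [FiniteDimensional F A]
    (h : IsGAlgGrading F 𝒜) (hs : IsGSimpleAlg F 𝒜) :
    multiplicationAlgebra h.isInternal = ⊤ := by
  classical
  have := isSimpleModule_multiplicationAlgebra h hs
  refine eq_top_iff.2 fun T _ => ?_
  let M := multiplicationAlgebra h.isInternal
  let T' : Module.End (Module.End M A) A :=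
    { toFun := T
      map_add' := map_add T
      map_smul' := fun f z => by
        obtain ⟨c, rfl⟩ :=
          (IsSimpleModule.algebraMap_end_bijective_of_isAlgClosed (A := M) (V := A) F).2 f
        simp }
  let b := Module.finBasis F A
  obtain ⟨r, hr⟩ := jacobson_density (R := M) T' (Finset.univ.image b)
  have : T = r := b.ext fun i => hr (b i) (by simp)
  exact this ▸ r.2

theorem exists_sandwich_eq [IsAlgClosed F] [FiniteDimensional F A]
    (h : IsGAlgGrading F 𝒜) (hs : IsGSimpleAlg F 𝒜) (T : Module.End F A) (g : G) :
    ∃ t, ∀ z ∈ 𝒜 g, sandwich F A t z = T z := by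
  have hT : T ∈ multiplicationAlgebra h.isInternal := multiplicationAlgebra_eq_top h hs ▸ trivial
  choose t ht using hT g
  refine ⟨∑ k ∈ (finite_ne_bot h.isInternal).toFinset, t k, fun z hz => ?_⟩
  rw [← sum_gradedProj h.isInternal (T z)]
  simp [ht _ z hz, LinearMap.sum_apply]

end Density

section Frames

open scoped TensorProduct

variable {F : Type*} [Field F] {G : Type*}
  {A : Type*} [Ring A] [Algebra F A] {𝒜 : G → Submodule F A} {n : G → ℕ}

theorem exists_eq_sum_smul [FiniteDimensional F A] (hn : ∀ g, Module.finrank F (𝒜 g) = n g)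
    {v : ℕ × G → A} (hv : ∀ i g, v (i, g) ∈ 𝒜 g)
    (hli : ∀ g, LinearIndependent F fun i : Fin (n g) => v (i, g)) {g : G} {z : A}
    (hz : z ∈ 𝒜 g) : ∃ c : Fin (n g) → F, ∑ i, c i • v (i, g) = z := by
  let w : Fin (n g) → 𝒜 g := fun i => ⟨v (i, g), hv i g⟩
  have hw : LinearIndependent F w := LinearIndependent.of_comp (𝒜 g).subtype (hli g)
  have hspan := hw.span_eq_top_of_card_eq_finrank' (by simp [hn])
  obtain ⟨c, hc⟩ := (Submodule.mem_span_range_iff_exists_fun F).1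
    (hspan ▸ Submodule.mem_top : (⟨z, hz⟩ : 𝒜 g) ∈ Submodule.span F (Set.range w))
  exact ⟨c, by simpa [w] using congrArg Subtype.val hc⟩

/-- The Capelli polynomial in the variables of degree `g`. -/
noncomputable def gradedCapelli
    (t : ∀ g, Fin (n g) → FreeAlgebra F (ℕ × G) ⊗[F] FreeAlgebra F (ℕ × G)) (g : G) :
    FreeAlgebra F (ℕ × G) :=
  capelli (t g) fun i => FreeAlgebra.ι F (i, g)

variable {t : ∀ g, Fin (n g) → FreeAlgebra F (ℕ × G) ⊗[F] FreeAlgebra F (ℕ × G)}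

theorem lift_gradedCapelli_eq_zero {v : ℕ × G → A} {g : G}
    (h : ¬ LinearIndependent F fun i : Fin (n g) => v (i, g)) :
    FreeAlgebra.lift F v (gradedCapelli t g) = 0 := by
  rw [gradedCapelli, map_capelli]
  simp only [FreeAlgebra.lift_ι_apply]
  exact AlternatingMap.map_linearDependent _ _ h

variable [Group G]

/-- The index type of the structure constants of a graded algebra with a homogeneous basis having
`n g` elements of degree `g`. -/
abbrev StructureIndex (n : G → ℕ) : Type _ :=
  Σ g : G, Σ h : G, Fin (n g) × Fin (n h) × Fin (n (g * h))

/-- The elements `v (i, g)` with `i < n g` are homogeneous, linearly independent, and multiply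
according to the structure constants `c`. -/
structure IsGradedFrame (𝒜 : G → Submodule F A) (n : G → ℕ) (v : ℕ × G → A)
    (c : StructureIndex n → F) : Prop where
  mem : ∀ i g, v (i, g) ∈ 𝒜 g
  linearIndependent : ∀ g, LinearIndependent F fun i : Fin (n g) => v (i, g)
  mul : ∀ g h (i : Fin (n g)) (j : Fin (n h)),
    v (i, g) * v (j, h) = ∑ k : Fin (n (g * h)), c ⟨g, h, i, j, k⟩ • v (k, g * h)

theorem exists_isGradedFrame_of_linearIndependent [DecidableEq G] [FiniteDimensional F A]
    (h𝒜 : IsGAlgGrading F 𝒜) (hn : ∀ g, Module.finrank F (𝒜 g) = n g)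
    {v : ℕ × G → A} (hv : ∀ i g, v (i, g) ∈ 𝒜 g)
    (hli : ∀ g, LinearIndependent F fun i : Fin (n g) => v (i, g)) :
    ∃ c, IsGradedFrame 𝒜 n v c := by
  choose c hc using fun g h (i : Fin (n g)) (j : Fin (n h)) =>
    exists_eq_sum_smul hn hv hli (h𝒜.mul_mem (hv i g) (hv j h))
  exact ⟨fun x => c x.1 x.2.1 x.2.2.1 x.2.2.2.1 x.2.2.2.2, hv, hli,
    fun g h i j => (hc g h i j).symm⟩

theorem exists_isGradedFrame [DecidableEq G] [FiniteDimensional F A]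
    (h𝒜 : IsGAlgGrading F 𝒜) (hn : ∀ g, Module.finrank F (𝒜 g) = n g) :
    ∃ v c, IsGradedFrame 𝒜 n v c := by
  let b g := Module.finBasisOfFinrankEq F (𝒜 g) (hn g)
  let v : ℕ × G → A := fun x => if h : x.1 < n x.2 then b x.2 ⟨x.1, h⟩ else 0
  have hb (g : G) (i : Fin (n g)) : v (i, g) = b g i := dif_pos i.2
  refine ⟨v, exists_isGradedFrame_of_linearIndependent h𝒜 hn (fun i g => ?_) fun g => ?_⟩
  · by_cases h : i < n g
    · exact hb g ⟨i, h⟩ ▸ (b g ⟨i, h⟩).2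
    · simp [v, h]
  · simp only [hb]
    exact (b g).linearIndependent.map' (𝒜 g).subtype (Submodule.ker_subtype _)

variable (t) in
/-- The Capelli polynomial in the variables of degree `g * h` whose `k`-th variable is replaced by
a product of variables of degrees `g` and `h`. -/
noncomputable def gradedCapelliNum (x : StructureIndex n) : FreeAlgebra F (ℕ × G) :=
  capelli (t (x.1 * x.2.1)) (Function.update
    (fun i : Fin (n (x.1 * x.2.1)) => FreeAlgebra.ι F ((i : ℕ), x.1 * x.2.1)) x.2.2.2.2
    (FreeAlgebra.ι F ((x.2.2.1 : ℕ), x.1) * FreeAlgebra.ι F ((x.2.2.2.1 : ℕ), x.2.1)))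

theorem IsGradedFrame.lift_gradedCapelliNum {v : ℕ × G → A} {c : StructureIndex n → F}
    (hv : IsGradedFrame 𝒜 n v c) (x : StructureIndex n) :
    FreeAlgebra.lift F v (gradedCapelliNum t x) =
      c x • FreeAlgebra.lift F v (gradedCapelli t (x.1 * x.2.1)) := by
  obtain ⟨g, h, i, j, k⟩ := x
  rw [gradedCapelli, gradedCapelliNum, map_capelli, map_capelli]
  have : (fun l => FreeAlgebra.lift F v (Function.update
      (fun i : Fin (n (g * h)) => FreeAlgebra.ι F ((i : ℕ), g * h)) k
      (FreeAlgebra.ι F ((i : ℕ), g) * FreeAlgebra.ι F ((j : ℕ), h)) l)) =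
      Function.update (fun l : Fin (n (g * h)) => v (l, g * h)) k
        (∑ l, c ⟨g, h, i, j, l⟩ • v (l, g * h)) := by
    ext l
    rw [← hv.mul]
    by_cases hl : l = k
    · subst hl; simp
    · simp [hl]
  rw [this, AlternatingMap.map_update_sum_smul]
  simp

variable (t) in
/-- `Realizes t q Q s` means that `Q` is obtained from the polynomial `q` in the structure constants
by clearing denominators, the common denominator being the product `s` of Capelli polynomials. -/
inductive Realizes : MvPolynomial (StructureIndex n) F → FreeAlgebra F (ℕ × G) →
    FreeAlgebra F (ℕ × G) → Prop
  | C (a : F) : Realizes (MvPolynomial.C a) (algebraMap F _ a) 1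
  | add {q q' Q Q' s s'} : Realizes q Q s → Realizes q' Q' s' →
      Realizes (q + q') (Q * s' + s * Q') (s * s')
  | mul_X {q Q s} (x : StructureIndex n) : Realizes q Q s →
      Realizes (q * MvPolynomial.X x) (Q * gradedCapelliNum t x)
        (s * gradedCapelli t (x.1 * x.2.1))

variable (t) in
theorem exists_realizes (q : MvPolynomial (StructureIndex n) F) : ∃ Q s, Realizes t q Q s := by
  induction q using MvPolynomial.induction_on with
  | C a => exact ⟨_, _, .C a⟩
  | add q q' hq hq' =>
    obtain ⟨Q, s, h⟩ := hq
    obtain ⟨Q', s', h'⟩ := hq'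
    exact ⟨_, _, h.add h'⟩
  | mul_X q x hq =>
    obtain ⟨Q, s, h⟩ := hq
    exact ⟨_, _, h.mul_X x⟩

theorem Realizes.lift_eq {q : MvPolynomial (StructureIndex n) F} {Q s : FreeAlgebra F (ℕ × G)}
    (h : Realizes t q Q s) {v : ℕ × G → A} {c : StructureIndex n → F}
    (hv : IsGradedFrame 𝒜 n v c) :
    FreeAlgebra.lift F v Q = MvPolynomial.eval c q • FreeAlgebra.lift F v s := by
  induction h with
  | C a => simp [Algebra.algebraMap_eq_smul_one]
  | add _ _ h h' => simp [h, h', add_smul]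
  | mul_X x _ h => simp [h, hv.lift_gradedCapelliNum, smul_smul, mul_comm]

theorem Realizes.lift_denominator_eq_one {q : MvPolynomial (StructureIndex n) F}
    {Q s : FreeAlgebra F (ℕ × G)} (h : Realizes t q Q s) {v : ℕ × G → A}
    (hv : ∀ g, FreeAlgebra.lift F v (gradedCapelli t g) = 1) : FreeAlgebra.lift F v s = 1 := by
  induction h with
  | C a => simp
  | add _ _ h h' => simp [h, h']
  | mul_X x _ h => simp [h, hv]

variable [DecidableEq G] [FiniteDimensional F A]

theorem IsGradedFrame.lift_surjective (h𝒜 : IsGAlgGrading F 𝒜)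
    (hn : ∀ g, Module.finrank F (𝒜 g) = n g) {v : ℕ × G → A} {c : StructureIndex n → F}
    (hv : IsGradedFrame 𝒜 n v c) : Function.Surjective (FreeAlgebra.lift F v) := by
  intro a
  change a ∈ (FreeAlgebra.lift F v).range
  induction a using graded_induction h𝒜.isInternal with
  | zero => exact zero_mem _
  | add a b ha hb => exact add_mem ha hb
  | hom g a ha =>
    obtain ⟨c, rfl⟩ := exists_eq_sum_smul hn hv.mem hv.linearIndependent ha
    exact sum_mem fun i _ => Subalgebra.smul_mem _
      ((AlgHom.mem_range _).2 ⟨FreeAlgebra.ι F ((i : ℕ), g), by simp⟩) _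

theorem IsGradedFrame.exists_gradedCapelli_eq_one [IsAlgClosed F] (h𝒜 : IsGAlgGrading F 𝒜)
    (hs : IsGSimpleAlg F 𝒜) (hn : ∀ g, Module.finrank F (𝒜 g) = n g) {v : ℕ × G → A}
    {c : StructureIndex n → F} (hv : IsGradedFrame 𝒜 n v c) :
    ∃ t : ∀ g, Fin (n g) → FreeAlgebra F (ℕ × G) ⊗[F] FreeAlgebra F (ℕ × G),
      ∀ g, FreeAlgebra.lift F v (gradedCapelli t g) = 1 := by
  have key (g : G) (k : Fin (n g)) : ∃ t : FreeAlgebra F (ℕ × G) ⊗[F] FreeAlgebra F (ℕ × G),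
      ∀ l : Fin (n g), sandwich F A (TensorProduct.map (FreeAlgebra.lift F v).toLinearMap
        (FreeAlgebra.lift F v).toLinearMap t) (v (l, g)) = if l = k then 1 else 0 := by
    let b := Module.Basis.span (hv.linearIndependent g)
    obtain ⟨f, hf⟩ := LinearMap.exists_extend (b.coord k)
    obtain ⟨t, ht⟩ := exists_sandwich_eq h𝒜 hs (f.smulRight 1) g
    have hsurj := hv.lift_surjective h𝒜 hn
    obtain ⟨t, rfl⟩ := TensorProduct.map_surjective (g := (FreeAlgebra.lift F v).toLinearMap)
      (g' := (FreeAlgebra.lift F v).toLinearMap) hsurj hsurj t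
    refine ⟨t, fun l => ?_⟩
    have hl : f (v (l, g)) = if l = k then 1 else 0 := by
      have := LinearMap.congr_fun hf (b l)
      simpa [b, Module.Basis.span_apply, Finsupp.single_apply] using this
    rw [ht _ (hv.mem l g), LinearMap.smulRight_apply, hl, ite_smul, one_smul, zero_smul]
  choose t ht using key
  refine ⟨t, fun g => ?_⟩
  rw [gradedCapelli, map_capelli]
  exact capelli_eq_one _ _ fun k l => by simpa using ht g k l

variable {B : Type*} [Ring B] [Algebra F B] [FiniteDimensional F B] {ℬ : G → Submodule F B}

theorem finrank_le_of_identities [IsAlgClosed F] (hℬ : IsGAlgGrading F ℬ) (hs : IsGSimpleAlg F ℬ)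
    (hid : ∀ p, IsGradedIdentity F 𝒜 p → IsGradedIdentity F ℬ p) (g : G) :
    Module.finrank F (ℬ g) ≤ Module.finrank F (𝒜 g) := by
  by_contra! hlt
  obtain ⟨v, c, hv⟩ := exists_isGradedFrame (n := fun g => Module.finrank F (ℬ g)) hℬ fun _ => rfl
  obtain ⟨t, ht⟩ := hv.exists_gradedCapelli_eq_one hℬ hs fun _ => rfl
  have h0 : FreeAlgebra.lift F v (gradedCapelli t g) = 0 := by
    refine hid _ (fun w hw => lift_gradedCapelli_eq_zero fun hli => hlt.not_ge ?_) v hv.mem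
    have : LinearIndependent F fun i : Fin (Module.finrank F (ℬ g)) => (⟨w (i, g), hw i g⟩ : 𝒜 g) :=
      LinearIndependent.of_comp (𝒜 g).subtype hli
    simpa using this.fintype_card_le_finrank
  obtain ⟨b, hb⟩ := hs.1
  exact hb (by rw [← one_mul b, ← ht g, h0, zero_mul])

theorem IsGradedFrame.eval_eq_zero [IsAlgClosed F] (h𝒜 : IsGAlgGrading F 𝒜)
    (hn : ∀ g, Module.finrank F (𝒜 g) = n g) (hℬ : IsGAlgGrading F ℬ) (hs : IsGSimpleAlg F ℬ)
    (hn' : ∀ g, Module.finrank F (ℬ g) = n g)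
    (hid : ∀ p, IsGradedIdentity F 𝒜 p → IsGradedIdentity F ℬ p)
    {q : MvPolynomial (StructureIndex n) F}
    (hq : ∀ v c, IsGradedFrame 𝒜 n v c → MvPolynomial.eval c q = 0) {v : ℕ × G → B}
    {c : StructureIndex n → F} (hv : IsGradedFrame ℬ n v c) : MvPolynomial.eval c q = 0 := by
  obtain ⟨t, ht⟩ := hv.exists_gradedCapelli_eq_one hℬ hs hn'
  obtain ⟨Q, s, hQ⟩ := exists_realizes t q
  let l := (finite_ne_bot h𝒜.isInternal).toFinset.toList
  have h0 : FreeAlgebra.lift F v (Q * (l.map (gradedCapelli t)).prod) = 0 := by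
    refine hid _ (fun w hw => ?_) v hv.mem
    by_cases hli : ∀ g, LinearIndependent F fun i : Fin (n g) => w (i, g)
    · obtain ⟨d, hd⟩ := exists_isGradedFrame_of_linearIndependent h𝒜 hn hw hli
      rw [map_mul, hQ.lift_eq hd, hq w d hd, zero_smul, zero_mul]
    · push Not at hli
      obtain ⟨g, hg⟩ := hli
      have hgl : g ∈ l := by
        simp only [l, Finset.mem_toList, Set.Finite.mem_toFinset, Set.mem_ofPred_eq]
        intro hbot
        have : n g = 0 := by rw [← hn, hbot, finrank_bot]
        have : IsEmpty (Fin (n g)) := by rw [this]; infer_instance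
        exact hg linearIndependent_empty_type
      rw [map_mul, map_list_prod, List.prod_eq_zero, mul_zero]
      rw [List.map_map]
      exact List.mem_map.2 ⟨g, hgl, lift_gradedCapelli_eq_zero hg⟩
  have h1 : FreeAlgebra.lift F v (l.map (gradedCapelli t)).prod = 1 := by
    rw [map_list_prod, List.map_map]
    exact List.prod_eq_one fun x hx => by
      obtain ⟨g, -, rfl⟩ := List.mem_map.1 hx
      exact ht g
  rw [map_mul, h1, mul_one, hQ.lift_eq hv, hQ.lift_denominator_eq_one ht] at h0
  obtain ⟨b, hb⟩ := hs.1
  refine (smul_eq_zero.1 h0).resolve_right fun h => hb ?_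
  rw [← one_mul b, h, zero_mul]

end Frames

section Parametrization

universe u v w

variable {F : Type u} [Field F] {G : Type v}
  {A : Type w} [Ring A] [Algebra F A] {𝒜 : G → Submodule F A} {n : G → ℕ}

variable (n) in
/-- Coordinates on the homogeneous changes of basis. -/
abbrev ChangeIndex : Type _ := Σ g : G, Fin (n g) × Fin (n g)

variable (F n) in
/-- The generic matrix of degree `g`. -/
noncomputable def genericChange (g : G) :
    Matrix (Fin (n g)) (Fin (n g)) (MvPolynomial (ChangeIndex n) F) :=
  Matrix.of fun i j => MvPolynomial.X ⟨g, i, j⟩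

theorem aeval_det_genericChange {R : Type*} [CommRing R] [Algebra F R]
    (T : ∀ g, Matrix (Fin (n g)) (Fin (n g)) R) (g : G) :
    MvPolynomial.aeval (fun x : ChangeIndex n => T x.1 x.2.1 x.2.2) (genericChange F n g).det =
      (T g).det := by
  rw [AlgHom.map_det]
  congr 1
  ext i j
  simp [genericChange]

variable [Group G]

/-- The structure constants obtained from `a` by the homogeneous change of basis `T` with
inverse `U`. -/
def changedStructure {R : Type*} [CommRing R] [Algebra F R] (a : StructureIndex n → F)
    (T U : ∀ g, Matrix (Fin (n g)) (Fin (n g)) R) (x : StructureIndex n) : R :=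
  ∑ l, ∑ l', ∑ r, T x.1 x.2.2.1 l * T x.2.1 x.2.2.2.1 l' *
    algebraMap F R (a ⟨x.1, x.2.1, l, l', r⟩) * U (x.1 * x.2.1) r x.2.2.2.2

theorem map_changedStructure {R : Type*} [CommRing R] [Algebra F R] (p : R →ₐ[F] F)
    (a : StructureIndex n → F) (T U : ∀ g, Matrix (Fin (n g)) (Fin (n g)) R)
    (x : StructureIndex n) : p (changedStructure a T U x) =
      changedStructure a (fun g => (T g).map p) (fun g => (U g).map p) x := by
  simp [changedStructure]

theorem IsGradedFrame.change {w : ℕ × G → A} {a : StructureIndex n → F}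
    (hw : IsGradedFrame 𝒜 n w a) {T U : ∀ g, Matrix (Fin (n g)) (Fin (n g)) F}
    (hTU : ∀ g, T g * U g = 1) {v : ℕ × G → A} (hv : ∀ i g, v (i, g) ∈ 𝒜 g)
    (hvw : ∀ g (i : Fin (n g)), v (i, g) = ∑ l, T g i l • w (l, g)) :
    IsGradedFrame 𝒜 n v (changedStructure a T U) where
  mem := hv
  linearIndependent g := by
    rw [Fintype.linearIndependent_iff]
    intro d hd
    have h1 : Matrix.vecMul d (T g) = 0 := by
      funext l
      refine Fintype.linearIndependent_iff.1 (hw.linearIndependent g) _ ?_ l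
      rw [← hd]
      simp only [hvw, Matrix.vecMul, dotProduct, Finset.sum_smul, Finset.smul_sum, smul_smul]
      exact Finset.sum_comm
    have h2 : d = 0 := by
      rw [← Matrix.vecMul_one d, ← hTU g, ← Matrix.vecMul_vecMul, h1, Matrix.zero_vecMul]
    exact fun i => congrFun h2 i
  mul g h i j := by
    have hU : ∀ r, ∑ k, U (g * h) r k • v (k, g * h) = w (r, g * h) := fun r => by
      have := mul_eq_one_comm.1 (hTU (g * h))
      simp only [hvw, Finset.smul_sum, smul_smul]
      rw [Finset.sum_comm]
      simp only [← Finset.sum_smul, ← Matrix.mul_apply, this, Matrix.one_apply, ite_smul, one_smul,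
        zero_smul, Finset.sum_ite_eq, Finset.mem_univ, if_true]
    calc v (i, g) * v (j, h)
        = ∑ l, ∑ l', ∑ r, (T g i l * T h j l' * a ⟨g, h, l, l', r⟩) • w (r, g * h) := by
          rw [hvw, hvw, Finset.sum_mul_sum]
          refine Finset.sum_congr rfl fun l _ => Finset.sum_congr rfl fun l' _ => ?_
          rw [smul_mul_smul_comm, hw.mul, Finset.smul_sum]
          simp only [smul_smul]
      _ = _ := by
          simp only [← hU, changedStructure, Finset.sum_smul, Finset.smul_sum, smul_smul,
            Algebra.algebraMap_self, RingHom.id_apply]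
          change _ = ∑ k : Fin (n (g * h)), ∑ l : Fin (n g), ∑ l' : Fin (n h),
            ∑ r : Fin (n (g * h)),
              (T g i l * T h j l' * a ⟨g, h, l, l', r⟩ * U (g * h) r k) • v (k, g * h)
          symm
          rw [Finset.sum_comm]
          refine Finset.sum_congr rfl fun l _ => ?_
          rw [Finset.sum_comm]
          refine Finset.sum_congr rfl fun l' _ => ?_
          exact Finset.sum_comm

theorem IsGradedFrame.structure_unique {v v' : ℕ × G → A} {c c' : StructureIndex n → F}
    (hv : IsGradedFrame 𝒜 n v c) (hv' : IsGradedFrame 𝒜 n v' c')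
    (h : ∀ g (i : Fin (n g)), v (i, g) = v' (i, g)) : c = c' := by
  funext ⟨g, k, i, j, l⟩
  refine sub_eq_zero.1 (Fintype.linearIndependent_iff.1 (hv.linearIndependent (g * k))
    (fun l => c ⟨g, k, i, j, l⟩ - c' ⟨g, k, i, j, l⟩) ?_ l)
  simp only [sub_smul, Finset.sum_sub_distrib, ← hv.mul]
  simp only [h, ← hv'.mul, sub_self]

theorem IsGradedFrame.exists_change [FiniteDimensional F A]
    (hn : ∀ g, Module.finrank F (𝒜 g) = n g)
    {v w : ℕ × G → A} {a c : StructureIndex n → F} (hw : IsGradedFrame 𝒜 n w a)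
    (hv : IsGradedFrame 𝒜 n v c) :
    ∃ T : ∀ g, Matrix (Fin (n g)) (Fin (n g)) F, (∀ g, (T g).det ≠ 0) ∧
      ∀ g (i : Fin (n g)), v (i, g) = ∑ l, T g i l • w (l, g) := by
  choose T hT using fun g (i : Fin (n g)) =>
    exists_eq_sum_smul hn hw.mem hw.linearIndependent (hv.mem i g)
  choose U hU using fun g (i : Fin (n g)) =>
    exists_eq_sum_smul hn hv.mem hv.linearIndependent (hw.mem i g)
  refine ⟨fun g => Matrix.of (T g), fun g => ?_, fun g i => (hT g i).symm⟩
  refine (Matrix.isUnit_det_of_right_inverse (B := Matrix.of (U g)) ?_).ne_zero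
  ext i j
  refine sub_eq_zero.1 (Fintype.linearIndependent_iff.1 (hv.linearIndependent g)
    (fun j => (Matrix.of (T g) * Matrix.of (U g)) i j - (1 : Matrix _ _ F) i j) ?_ j)
  simp only [sub_smul, Finset.sum_sub_distrib, Matrix.mul_apply, Finset.sum_smul, Matrix.of_apply,
    Matrix.one_apply, ite_smul, one_smul, zero_smul, Finset.sum_ite_eq, Finset.mem_univ, if_true]
  rw [Finset.sum_comm]
  simp only [mul_smul, ← Finset.smul_sum, hU, hT, sub_self]

theorem exists_parametrization [DecidableEq G] [FiniteDimensional F A] (h𝒜 : IsGAlgGrading F 𝒜)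
    (hn : ∀ g, Module.finrank F (𝒜 g) = n g) :
    ∃ (P : Type (max u v)) (_ : CommRing P) (_ : IsDomain P) (_ : Algebra F P)
      (_ : Algebra.FiniteType F P) (α : MvPolynomial (StructureIndex n) F →ₐ[F] P),
      (∀ p : P →ₐ[F] F, ∃ c ∈ {c | ∃ v, IsGradedFrame 𝒜 n v c}, p.comp α = MvPolynomial.aeval c) ∧
      ∀ c ∈ {c | ∃ v, IsGradedFrame 𝒜 n v c}, ∃ p : P →ₐ[F] F, p.comp α = MvPolynomial.aeval c := by
  let S := (finite_ne_bot h𝒜.isInternal).toFinset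
  have hS (g : G) (hg : g ∉ S) : IsEmpty (Fin (n g)) := by
    have hbot : 𝒜 g = ⊥ := by simpa [S] using hg
    have : n g = 0 := by rw [← hn, hbot, finrank_bot]
    rw [this]
    infer_instance
  have : Finite (ChangeIndex n) := by
    refine Finite.of_injective (β := Σ g : S, Fin (n g) × Fin (n g))
      (fun x => ⟨⟨x.1, by_contra fun hg => (hS x.1 hg).false x.2.1⟩, x.2⟩) ?_
    rintro ⟨g, x⟩ ⟨h, y⟩ hxy
    simp only [Sigma.mk.injEq, Subtype.mk.injEq] at hxy
    obtain ⟨rfl, h⟩ := hxy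
    simpa using h
  let d : MvPolynomial (ChangeIndex n) F := ∏ g ∈ S, (genericChange F n g).det
  have hd : d ≠ 0 := by
    intro h
    have := congrArg (MvPolynomial.aeval fun x : ChangeIndex n =>
      (1 : Matrix (Fin (n x.1)) (Fin (n x.1)) F) x.2.1 x.2.2) h
    simp only [d, map_prod, aeval_det_genericChange (fun _ => (1 : Matrix _ _ F)),
      Matrix.det_one, Finset.prod_const_one, map_zero] at this
    exact one_ne_zero this
  let P := Localization.Away d
  have hdom : IsDomain P :=
    IsLocalization.isDomain_localization (powers_le_nonZeroDivisors_of_noZeroDivisors hd)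
  have : Algebra.FiniteType (MvPolynomial (ChangeIndex n) F) P :=
    IsLocalization.finiteType_of_monoid_fg (Submonoid.powers d) _
  have hfin : Algebra.FiniteType F P :=
    Algebra.FiniteType.trans (S := MvPolynomial (ChangeIndex n) F) inferInstance this
  let T (g : G) : Matrix (Fin (n g)) (Fin (n g)) P := (genericChange F n g).map (algebraMap _ P)
  have hT (g : G) : IsUnit (T g).det := by
    by_cases hg : g ∈ S
    · have hdet : (T g).det = algebraMap _ P (genericChange F n g).det :=
        (RingHom.map_det _ _).symm
      rw [hdet]
      exact isUnit_of_dvd_unit (map_dvd (algebraMap _ P)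
        (Finset.dvd_prod_of_mem (fun g => (genericChange F n g).det) hg))
        (IsLocalization.Away.algebraMap_isUnit d)
    · have := hS g hg
      simp
  obtain ⟨w, a, hw⟩ := exists_isGradedFrame h𝒜 hn
  let α : MvPolynomial (StructureIndex n) F →ₐ[F] P :=
    MvPolynomial.aeval (changedStructure a T fun g => (T g)⁻¹)
  have hα (p : P →ₐ[F] F) : p.comp α = MvPolynomial.aeval
      (changedStructure a (fun g => (T g).map p) fun g => ((T g)⁻¹).map p) := by
    ext x
    simp [α, map_changedStructure]
  have hinv (p : P →ₐ[F] F) (g : G) : (T g).map p * ((T g)⁻¹).map p = 1 := by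
    rw [← Matrix.map_mul, Matrix.mul_nonsing_inv _ (hT g), Matrix.map_one _ (map_zero p) (map_one p)]
  refine ⟨P, inferInstance, hdom, inferInstance, hfin, α, fun p => ?_, fun c ⟨v, hv⟩ => ?_⟩
  · refine ⟨_, ⟨fun x => if h : x.1 < n x.2 then
      ∑ l : Fin (n x.2), (T x.2).map p ⟨x.1, h⟩ l • w (l, x.2) else 0,
      hw.change (hinv p) (fun i g => ?_) (fun g i => ?_)⟩, hα p⟩
    · split_ifs
      · exact sum_mem fun l _ => Submodule.smul_mem _ _ (hw.mem l g)
      · exact zero_mem _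
    · simp
  · obtain ⟨M, hM, hvw⟩ := hw.exists_change hn hv
    have hu (y : Submonoid.powers d) : IsUnit (MvPolynomial.aeval (R := F)
        (fun x : ChangeIndex n => M x.1 x.2.1 x.2.2) (y : MvPolynomial (ChangeIndex n) F)) := by
      obtain ⟨_, k, rfl⟩ := y
      simp only [d, map_pow, map_prod, aeval_det_genericChange]
      exact (IsUnit.mk0 _ (Finset.prod_ne_zero_iff.2 fun g _ => hM g)).pow k
    let p : P →ₐ[F] F := IsLocalization.liftAlgHom (M := Submonoid.powers d) hu
    have hp (g : G) : (T g).map p = M g := by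
      ext i j
      simp [T, p, genericChange]
    refine ⟨p, ?_⟩
    rw [hα, hv.structure_unique (hw.change (hinv p) hv.mem fun g i => ?_) fun _ _ => rfl]
    rw [hp, hvw]

end Parametrization

section Comparison

theorem eval_eq_zero_iff_of_parametrization {F : Type*} [Field F] [IsAlgClosed F] {σ R : Type*}
    [CommRing R] [IsDomain R] [Algebra F R] [Algebra.FiniteType F R] {γ : MvPolynomial σ F →ₐ[F] R}
    {S : Set (σ → F)} (hγ : ∀ p : R →ₐ[F] F, ∃ c ∈ S, p.comp γ = MvPolynomial.aeval c)
    (hγ' : ∀ c ∈ S, ∃ p : R →ₐ[F] F, p.comp γ = MvPolynomial.aeval c) (q : MvPolynomial σ F) :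
    γ q = 0 ↔ ∀ c ∈ S, MvPolynomial.eval c q = 0 := by
  refine ⟨fun h c hc => ?_, fun h => by_contra fun hq => ?_⟩
  · obtain ⟨p, hp⟩ := hγ' c hc
    have := DFunLike.congr_fun hp q
    rw [AlgHom.comp_apply, h, map_zero, MvPolynomial.aeval_eq_eval] at this
    exact this.symm
  · obtain ⟨p, hp⟩ := exists_algHom_apply_ne_zero (F := F) hq
    obtain ⟨c, hc, hpc⟩ := hγ p
    refine hp ?_
    rw [← AlgHom.comp_apply, hpc, MvPolynomial.aeval_eq_eval]
    exact h c hc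

variable {F : Type*} [Field F] {G : Type*} [Group G] {A B : Type*} [Ring A] [Algebra F A]
  [Ring B] [Algebra F B] {𝒜 : G → Submodule F A} {ℬ : G → Submodule F B} {n : G → ℕ}

theorem IsGradedIdentity.of_algEquiv {φ : A ≃ₐ[F] B} (hφ : ∀ g x, x ∈ 𝒜 g → φ x ∈ ℬ g)
    {p : FreeAlgebra F (ℕ × G)} (hp : IsGradedIdentity F ℬ p) : IsGradedIdentity F 𝒜 p := by
  intro v hv
  have h : FreeAlgebra.lift F (φ ∘ v) = φ.toAlgHom.comp (FreeAlgebra.lift F v) := by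
    ext; simp
  have := hp (φ ∘ v) fun i g => hφ g _ (hv i g)
  rw [h] at this
  exact (map_eq_zero_iff φ φ.injective).1 this

variable [DecidableEq G] [FiniteDimensional F A] [FiniteDimensional F B]

theorem exists_common_structure [IsAlgClosed F] (h𝒜 : IsGAlgGrading F 𝒜)
    (hℬ : IsGAlgGrading F ℬ) (hn : ∀ g, Module.finrank F (𝒜 g) = n g)
    (hn' : ∀ g, Module.finrank F (ℬ g) = n g)
    (h : ∀ q : MvPolynomial (StructureIndex n) F,
      (∀ v c, IsGradedFrame 𝒜 n v c → MvPolynomial.eval c q = 0) ↔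
        ∀ v c, IsGradedFrame ℬ n v c → MvPolynomial.eval c q = 0) :
    ∃ v w c, IsGradedFrame 𝒜 n v c ∧ IsGradedFrame ℬ n w c := by
  obtain ⟨P, _, _, _, _, α, hα, hα'⟩ := exists_parametrization h𝒜 hn
  obtain ⟨Q, _, _, _, _, β, hβ, hβ'⟩ := exists_parametrization hℬ hn'
  obtain ⟨p, q, hpq⟩ := exists_algHom_comp_eq_of_ker_eq α β fun x => by
    rw [eval_eq_zero_iff_of_parametrization hα hα', eval_eq_zero_iff_of_parametrization hβ hβ']
    simpa only [Set.mem_ofPred_eq, forall_exists_index, forall_comm (α := _ → F)] using h x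
  obtain ⟨c, ⟨v, hv⟩, hc⟩ := hα p
  obtain ⟨c', ⟨w, hw⟩, hc'⟩ := hβ q
  have : c = c' := by
    funext x
    simpa using DFunLike.congr_fun ((hc.symm.trans hpq).trans hc') (MvPolynomial.X x)
  exact ⟨v, w, c, hv, this ▸ hw⟩

theorem IsGradedFrame.exists_basis (h𝒜 : IsGAlgGrading F 𝒜)
    (hn : ∀ g, Module.finrank F (𝒜 g) = n g) {v : ℕ × G → A} {c : StructureIndex n → F}
    (hv : IsGradedFrame 𝒜 n v c) :
    ∃ b : Module.Basis (Σ g, Fin (n g)) F A, ∀ g i, b ⟨g, i⟩ = v (i, g) := by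
  have hli (g : G) : LinearIndependent F fun i : Fin (n g) => (⟨v (i, g), hv.mem i g⟩ : 𝒜 g) :=
    LinearIndependent.of_comp (𝒜 g).subtype (hv.linearIndependent g)
  let b (g : G) : Module.Basis (Fin (n g)) F (𝒜 g) :=
    Module.Basis.mk (hli g) ((hli g).span_eq_top_of_card_eq_finrank' (by simp [hn])).ge
  exact ⟨h𝒜.isInternal.collectedBasis b, fun g i => by simp [b]⟩

theorem IsGradedFrame.exists_algEquiv (h𝒜 : IsGAlgGrading F 𝒜)
    (hℬ : IsGAlgGrading F ℬ) (hn : ∀ g, Module.finrank F (𝒜 g) = n g)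
    (hn' : ∀ g, Module.finrank F (ℬ g) = n g) {v : ℕ × G → A} {w : ℕ × G → B}
    {c : StructureIndex n → F} (hv : IsGradedFrame 𝒜 n v c) (hw : IsGradedFrame ℬ n w c) :
    ∃ φ : A ≃ₐ[F] B, ∀ (g : G) (x : A), x ∈ 𝒜 g ↔ φ x ∈ ℬ g := by
  obtain ⟨b, hb⟩ := hv.exists_basis h𝒜 hn
  obtain ⟨b', hb'⟩ := hw.exists_basis hℬ hn'
  let e : A ≃ₗ[F] B := b.equiv b' (Equiv.refl _)
  have he (g : G) (i : Fin (n g)) : e (v (i, g)) = w (i, g) := by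
    rw [← hb, ← hb', Module.Basis.equiv_apply, Equiv.refl_apply]
  have hmul : (LinearMap.mul F A).compr₂ e.toLinearMap =
      (LinearMap.mul F B).compl₁₂ e.toLinearMap e.toLinearMap := by
    refine b.ext fun ⟨g, i⟩ => b.ext fun ⟨h, j⟩ => ?_
    simp [hb, hv.mul, hw.mul, he]
  have hmul' (x y : A) : e (x * y) = e x * e y := LinearMap.congr_fun₂ hmul x y
  have hone : e 1 = 1 := by
    have h (y : B) : e 1 * y = y := by
      obtain ⟨x, rfl⟩ := e.surjective y
      rw [← hmul', one_mul]
    simpa using h 1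
  refine ⟨AlgEquiv.ofLinearEquiv e hone hmul', fun g x => ⟨fun hx => ?_, fun hx => ?_⟩⟩
  · obtain ⟨d, rfl⟩ := exists_eq_sum_smul hn hv.mem hv.linearIndependent hx
    simp only [AlgEquiv.ofLinearEquiv_apply, map_sum, map_smul, he]
    exact sum_mem fun i _ => Submodule.smul_mem _ _ (hw.mem i g)
  · obtain ⟨d, hd⟩ := exists_eq_sum_smul hn' hw.mem hw.linearIndependent hx
    have : x = ∑ i, d i • v (i, g) := e.injective (by simpa [he] using hd.symm)
    rw [this]
    exact sum_mem fun i _ => Submodule.smul_mem _ _ (hv.mem i g)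

end Comparison

/-- **Aljadeff–Haile.** Two finite-dimensional `G`-simple `G`-graded algebras over an
algebraically closed field of characteristic zero are `G`-graded isomorphic if and only
if they satisfy the same `G`-graded polynomial identities. -/
theorem gsimple_graded_iso_iff_same_graded_identities
    {G : Type*} [Group G] [DecidableEq G]
    (F : Type*) [Field F] [IsAlgClosed F] [CharZero F]
    {A B : Type*} [Ring A] [Algebra F A] [Ring B] [Algebra F B]
    [FiniteDimensional F A] [FiniteDimensional F B]
    (𝒜 : G → Submodule F A) (ℬ : G → Submodule F B)
    (hA : IsGAlgGrading F 𝒜) (hB : IsGAlgGrading F ℬ)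
    (hAs : IsGSimpleAlg F 𝒜) (hBs : IsGSimpleAlg F ℬ) :
    (∃ φ : A ≃ₐ[F] B, ∀ (g : G) (x : A), x ∈ 𝒜 g ↔ φ x ∈ ℬ g) ↔
      (∀ p : FreeAlgebra F (ℕ × G), IsGradedIdentity F 𝒜 p ↔ IsGradedIdentity F ℬ p) := by
  refine ⟨fun ⟨φ, hφ⟩ p => ⟨IsGradedIdentity.of_algEquiv (φ := φ.symm) fun g x hx => ?_,
    IsGradedIdentity.of_algEquiv fun g x => (hφ g x).1⟩, fun hid => ?_⟩
  · rwa [hφ, AlgEquiv.apply_symm_apply]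
  have hn' (g : G) : Module.finrank F (ℬ g) = Module.finrank F (𝒜 g) :=
    (finrank_le_of_identities hB hBs (fun p => (hid p).1) g).antisymm
      (finrank_le_of_identities hA hAs (fun p => (hid p).2) g)
  obtain ⟨v, w, c, hv, hw⟩ := exists_common_structure hA hB (fun _ => rfl) hn' fun q =>
    ⟨fun hq v c hv => hv.eval_eq_zero hA (fun _ => rfl) hB hBs hn' (fun p => (hid p).1) hq,
      fun hq v c hv => hv.eval_eq_zero hB hn' hA hAs (fun _ => rfl) (fun p => (hid p).2) hq⟩
  exact hv.exists_algEquiv hA hB (fun _ => rfl) hn' hw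
end

section
/- Let F be an algebraically closed field of characteristic zero, G a group, A a finite-dimensional G-simple G-graded F-algebra, and B a finite-dimensional G-graded F-algebra. If Id_G(B) ⊆ Id_G(A), then dim_F A_g ≤ dim_F B_g for every g ∈ G. Consequently, if B is also G-simple and Id_G(A) = Id_G(B), then dim_F A_g = dim_F B_g for every g ∈ G (in particular dim_F A = dim_F B). -/
open scoped DirectSum

open Polynomial in
/-- In a finite-dimensional algebra, a non-nilpotent element `r` has a multiple `r * s`, with `s`
a polynomial in `r`, which is a nonzero idempotent. -/
theorem exists_mul_idempotent_of_not_isNilpotent {F A : Type*} [Field F] [Ring A] [Algebra F A]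
    [FiniteDimensional F A] {r : A} (hr : ¬ IsNilpotent r) :
    ∃ s ∈ Algebra.adjoin F {r}, s * r = r * s ∧ IsIdempotentElem (r * s) ∧ r * s ≠ 0 := by
  obtain ⟨q, hq, hqX⟩ := exists_eq_pow_rootMultiplicity_mul_and_not_dvd (minpoly F r)
    (minpoly.ne_zero (Algebra.IsIntegral.isIntegral r)) 0
  set k := (minpoly F r).rootMultiplicity 0
  rw [C_0, sub_zero] at hq hqX
  have hcop : IsCoprime (X ^ (k + 1)) q :=
    IsCoprime.pow_left ((irreducible_X.coprime_iff_not_dvd).2 hqX)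
  obtain ⟨u, v, huv⟩ := hcop
  have hzero : aeval r (X ^ (k + 1) * q) = 0 := by
    rw [pow_succ', mul_assoc, ← hq, map_mul, minpoly.aeval, mul_zero]
  have hrs : r * aeval r (u * X ^ k) = aeval r (u * X ^ (k + 1)) := by
    rw [pow_succ', mul_left_comm, map_mul (aeval r) X, aeval_X]
  refine ⟨aeval r (u * X ^ k), aeval_mem_adjoin_singleton F r, ?_, ?_, ?_⟩
  · have := congrArg (aeval r) (mul_comm (u * X ^ k) X)
    rwa [map_mul, map_mul _ X, aeval_X] at this
  · rw [hrs, IsIdempotentElem, ← map_mul, ← sub_eq_zero, ← map_sub]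
    have : u * X ^ (k + 1) * (u * X ^ (k + 1)) - u * X ^ (k + 1)
        = -(u * v) * (X ^ (k + 1) * q) := by
      linear_combination (u * X ^ (k + 1)) * huv
    rw [this, map_mul, hzero, mul_zero]
  · rw [hrs]
    intro h
    refine hr ⟨k + 1, ?_⟩
    have h1 := congrArg (aeval r) huv
    rw [map_add, h, zero_add, map_one] at h1
    have : aeval r (v * (X ^ (k + 1) * q)) = 0 := by rw [map_mul, hzero, mul_zero]
    rw [mul_left_comm, map_mul, h1, mul_one] at this
    simpa using this

/-- The alternating sum `∑ σ, sign σ • ∏ k, z k * x (σ k) * w k`, as an alternating map in `x`. -/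
noncomputable def capelliMap (F : Type*) [Field F] {C : Type*} [Ring C] [Algebra F C] {d : ℕ}
    (z w : Fin d → C) : C [⋀^Fin d]→ₗ[F] C :=
  MultilinearMap.alternatization ((MultilinearMap.mkPiAlgebraFin F d C).compLinearMap
    fun k => LinearMap.mulRight F (w k) ∘ₗ LinearMap.mulLeft F (z k))

theorem capelliMap_apply (F : Type*) [Field F] {C : Type*} [Ring C] [Algebra F C] {d : ℕ}
    (z w x : Fin d → C) :
    capelliMap F z w x = ∑ σ : Equiv.Perm (Fin d),
      Equiv.Perm.sign σ • (List.ofFn fun k => z k * x (σ k) * w k).prod := by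
  simp [capelliMap, MultilinearMap.alternatization_apply]

theorem map_capelliMap {F C D : Type*} [Field F] [Ring C] [Algebra F C] [Ring D] [Algebra F D]
    (φ : C →ₐ[F] D) {d : ℕ} (z w x : Fin d → C) :
    φ (capelliMap F z w x) = capelliMap F (φ ∘ z) (φ ∘ w) (φ ∘ x) := by
  simp [capelliMap_apply, map_sum, Units.smul_def, map_list_prod, List.map_ofFn,
    Function.comp_def]

/-- If off-diagonal products `z k * x l * w k` vanish, only one term of the alternating sum
survives. -/
theorem capelliMap_eq_prod {F C : Type*} [Field F] [Ring C] [Algebra F C] {d : ℕ}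
    {z w x : Fin d → C} (h : ∀ k l, l ≠ k → z k * x l * w k = 0) :
    capelliMap F z w x = (List.ofFn fun k => z k * x k * w k).prod := by
  rw [capelliMap_apply, Finset.sum_eq_single 1]
  · simp
  · intro σ _ hσ
    obtain ⟨k, hk⟩ : ∃ k, σ k ≠ k := by
      by_contra! hc
      exact hσ (Equiv.ext hc)
    rw [List.prod_eq_zero, smul_zero]
    exact (List.mem_ofFn' _ _).2 ⟨k, h k _ hk⟩
  · simp

/-- A Capelli polynomial in `d` alternating variables of degree `g` is an identity of any graded
algebra with fewer than `d` dimensions in degree `g`. -/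
theorem capelliMap_eq_zero_of_finrank_lt {F C : Type*} [Field F] [Ring C] [Algebra F C]
    [FiniteDimensional F C] {d : ℕ} {V : Submodule F C} (hd : Module.finrank F V < d)
    (z w : Fin d → C) {x : Fin d → C} (hx : ∀ k, x k ∈ V) : capelliMap F z w x = 0 := by
  refine AlternatingMap.map_linearDependent _ _ fun hli => ?_
  have h : LinearIndependent F fun k => (⟨x k, hx k⟩ : V) :=
    LinearIndependent.of_comp V.subtype hli
  have := h.fintype_card_le_finrank
  rw [Fintype.card_fin] at this
  omega

namespace IsGAlgGrading

variable {F G A : Type*} [Field F] [Group G] [Ring A] [Algebra F A] [DecidableEq G]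
  {𝒜 : G → Submodule F A}

theorem iSup_eq_top (hA : IsGAlgGrading F 𝒜) : ⨆ g, 𝒜 g = ⊤ :=
  hA.isInternal.submodule_iSup_eq_top

@[elab_as_elim]
theorem induction_on (hA : IsGAlgGrading F 𝒜) {P : A → Prop} (a : A)
    (mem : ∀ g, ∀ a ∈ 𝒜 g, P a) (zero : P 0) (add : ∀ a b, P a → P b → P (a + b)) : P a :=
  Submodule.iSup_induction 𝒜 (motive := P) (hA.iSup_eq_top ▸ Submodule.mem_top : a ∈ ⨆ g, 𝒜 g) mem zero add

/-- Projections onto the homogeneous components. -/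
theorem exists_proj (hA : IsGAlgGrading F 𝒜) (g : G) :
    ∃ π : A →ₗ[F] A, (∀ a, π a ∈ 𝒜 g) ∧ (∀ a ∈ 𝒜 g, π a = a) ∧
      ∀ h, h ≠ g → ∀ a ∈ 𝒜 h, π a = 0 := by
  let _ := hA.isInternal.chooseDecomposition
  exact ⟨(𝒜 g).subtype ∘ₗ DirectSum.component F G (fun g => 𝒜 g) g ∘ₗ
      (DirectSum.decomposeLinearEquiv 𝒜).toLinearMap,
    fun a => Subtype.prop _, fun a ha => DirectSum.decompose_of_mem_same 𝒜 ha,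
    fun h hh a ha => DirectSum.decompose_of_mem_ne 𝒜 ha hh⟩

theorem one_mem (hA : IsGAlgGrading F 𝒜) : (1 : A) ∈ 𝒜 1 := by
  obtain ⟨π, hπ1, hπ, hπ'⟩ := hA.exists_proj 1
  have key (h : G) (a : A) (ha : a ∈ 𝒜 h) : a * π 1 = a := by
    obtain ⟨ρ, -, hρ, hρ'⟩ := hA.exists_proj h
    have hmul (b : A) : ρ (a * b) = a * π b := by
      induction b using hA.induction_on with
      | mem k b hb =>
        by_cases hk : k = 1
        · subst hk
          rw [hπ b hb, hρ _ (by simpa using hA.mul_mem ha hb)]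
        · rw [hπ' k hk b hb, mul_zero, hρ' (h * k) (by simpa using hk) _ (hA.mul_mem ha hb)]
      | zero => simp
      | add b c hb hc => rw [mul_add, map_add, map_add, hb, hc, mul_add]
    rw [← hmul, mul_one, hρ a ha]
  have all (a : A) : a * π 1 = a := by
    induction a using hA.induction_on with
    | mem k b hb => exact key k b hb
    | zero => simp
    | add b c hb hc => rw [add_mul, hb, hc]
  rw [← all 1, one_mul]
  exact hπ1 1

theorem adjoin_le (hA : IsGAlgGrading F 𝒜) {r s : A} (hr : r ∈ 𝒜 1)
    (hs : s ∈ Algebra.adjoin F {r}) : s ∈ 𝒜 1 := by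
  induction hs using Algebra.adjoin_induction with
  | mem x hx => rwa [Set.mem_singleton_iff.1 hx]
  | algebraMap c => exact Algebra.algebraMap_eq_smul_one (R := F) (A := A) c ▸
      (𝒜 1).smul_mem c hA.one_mem
  | add x y _ _ hx hy => exact add_mem hx hy
  | mul x y _ _ hx hy => simpa using hA.mul_mem hx hy

/-- In a `G`-simple algebra, `1` is a sum of homogeneous multiples of any nonzero homogeneous
element. -/
theorem one_mem_span (hA : IsGAlgGrading F 𝒜) (hs : IsGSimpleAlg F 𝒜) {x : A} {g : G}
    (hx : x ∈ 𝒜 g) (hx0 : x ≠ 0) :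
    (1 : A) ∈ Submodule.span F {y | ∃ h k, ∃ a ∈ 𝒜 h, ∃ b ∈ 𝒜 k, y = a * x * b} := by
  set J := Submodule.span F {y | ∃ h k, ∃ a ∈ 𝒜 h, ∃ b ∈ 𝒜 k, y = a * x * b} with hJ
  have hleft (c y : A) (hy : y ∈ J) : c * y ∈ J := by
    induction c using hA.induction_on with
    | mem l c hc =>
      induction hy using Submodule.span_induction with
      | mem y hy =>
        obtain ⟨h, k, a, ha, b, hb, rfl⟩ := hy
        exact Submodule.subset_span ⟨_, k, c * a, hA.mul_mem hc ha, b, hb, by simp only [mul_assoc]⟩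
      | zero => simp
      | add y z _ _ hy hz => rw [mul_add]; exact add_mem hy hz
      | smul t y _ hy => rw [mul_smul_comm]; exact J.smul_mem _ hy
    | zero => simp
    | add b c hb hc => rw [add_mul]; exact add_mem hb hc
  have hright (c y : A) (hy : y ∈ J) : y * c ∈ J := by
    induction c using hA.induction_on with
    | mem l c hc =>
      induction hy using Submodule.span_induction with
      | mem y hy =>
        obtain ⟨h, k, a, ha, b, hb, rfl⟩ := hy
        exact Submodule.subset_span ⟨h, _, a, ha, b * c, hA.mul_mem hb hc, by simp only [mul_assoc]⟩
      | zero => simp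
      | add y z _ _ hy hz => rw [add_mul]; exact add_mem hy hz
      | smul t y _ hy => rw [smul_mul_assoc]; exact J.smul_mem _ hy
    | zero => simp
    | add b c hb hc => rw [mul_add]; exact add_mem hb hc
  have hxJ : x ∈ J :=
    Submodule.subset_span ⟨1, 1, 1, hA.one_mem, 1, hA.one_mem, by simp⟩
  let I : TwoSidedIdeal A := TwoSidedIdeal.mk' (J : Set A) J.zero_mem J.add_mem J.neg_mem
    (hleft _ _) (hright _ _)
  have hI (y : A) : y ∈ I ↔ y ∈ J := TwoSidedIdeal.mem_mk' _ _ _ _ _ _ _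
  have hIhom : ∀ a ∈ I, a ∈ Submodule.span F {y : A | (∃ g, y ∈ 𝒜 g) ∧ y ∈ I} := by
    intro a ha
    refine Submodule.span_mono ?_ ((hI a).1 ha)
    rintro y ⟨h, k, a, ha, b, hb, rfl⟩
    exact ⟨⟨_, hA.mul_mem (hA.mul_mem ha hx) hb⟩,
      (hI _).2 (Submodule.subset_span ⟨h, k, a, ha, b, hb, rfl⟩)⟩
  rcases hs.2 I hIhom with h | h
  · exact absurd ((TwoSidedIdeal.mem_bot A).1 (h ▸ (hI x).2 hxJ)) hx0
  · exact (hI 1).1 (h ▸ trivial)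

/-- `G`-simple algebras are graded prime. -/
theorem exists_mul_mul_ne_zero (hA : IsGAlgGrading F 𝒜) (hs : IsGSimpleAlg F 𝒜) {x y : A} {g : G}
    (hx : x ≠ 0) (hy : y ∈ 𝒜 g) (hy0 : y ≠ 0) : ∃ h, ∃ c ∈ 𝒜 h, x * c * y ≠ 0 := by
  by_contra! hc
  have hker : Submodule.span F {z | ∃ h k, ∃ a ∈ 𝒜 h, ∃ b ∈ 𝒜 k, z = a * y * b} ≤
      LinearMap.ker (LinearMap.mulLeft F x) := by
    rw [Submodule.span_le]
    rintro _ ⟨h, k, a, ha, b, hb, rfl⟩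
    simp [← mul_assoc, hc h a ha]
  exact hx (by simpa using hker (hA.one_mem_span hs hy hy0))

/-- A corner at a nonzero idempotent contains a non-nilpotent multiple, of degree one, of any
nonzero homogeneous element. -/
theorem exists_not_isNilpotent [CharZero F] [FiniteDimensional F A] (hA : IsGAlgGrading F 𝒜)
    (hs : IsGSimpleAlg F 𝒜) {e x : A} {g : G} (he : IsIdempotentElem e) (he0 : e ≠ 0)
    (hx : x ∈ 𝒜 g) (hx0 : x ≠ 0) :
    ∃ h k, ∃ a ∈ 𝒜 h, ∃ b ∈ 𝒜 k, h * g * k = 1 ∧ ¬ IsNilpotent (e * (a * x * b) * e) := by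
  by_contra! hc
  obtain ⟨π, -, hπ, hπ'⟩ := hA.exists_proj 1
  let τ : A →ₗ[F] F := LinearMap.trace F A ∘ₗ LinearMap.mul F A ∘ₗ
    LinearMap.mulRight F e ∘ₗ LinearMap.mulLeft F e ∘ₗ π
  have hτ (y : A) : τ y = LinearMap.trace F A (LinearMap.mulLeft F (e * π y * e)) := rfl
  have hker : Submodule.span F {y | ∃ h k, ∃ a ∈ 𝒜 h, ∃ b ∈ 𝒜 k, y = a * x * b} ≤
      LinearMap.ker τ := by
    rw [Submodule.span_le]
    rintro _ ⟨h, k, a, ha, b, hb, rfl⟩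
    have hm := hA.mul_mem (hA.mul_mem ha hx) hb
    rw [SetLike.mem_coe, LinearMap.mem_ker, hτ]
    by_cases hk : h * g * k = 1
    · rw [hπ _ (hk ▸ hm)]
      refine (LinearMap.isNilpotent_trace_of_isNilpotent ?_).eq_zero
      obtain ⟨n, hn⟩ := hc h k a ha b hb hk
      exact ⟨n, by rw [LinearMap.pow_mulLeft, hn, LinearMap.mulLeft_zero_eq_zero]⟩
    · rw [hπ' _ hk _ hm]
      simp
  have h1 : τ 1 = 0 := hker (hA.one_mem_span hs hx hx0)
  rw [hτ, hπ _ hA.one_mem, mul_one, he.eq] at h1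
  have hidem : IsIdempotentElem (LinearMap.mulLeft F e) := by
    rw [IsIdempotentElem, Module.End.mul_eq_comp, ← LinearMap.mulLeft_mul, he.eq]
  rw [(LinearMap.IsIdempotentElem.isProj_range _ hidem).trace, Nat.cast_eq_zero,
    Submodule.finrank_eq_zero, LinearMap.range_eq_bot] at h1
  exact he0 (by simpa using LinearMap.congr_fun h1 1)

end IsGAlgGrading

/-- `e` is a nonzero idempotent of `V` which dominates no idempotent of `V` other than `0`
and `e`. -/
structure IsPrimitiveIdempotentIn {F A : Type*} [Field F] [Ring A] [Algebra F A]
    (V : Submodule F A) (e : A) : Prop where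
  mem : e ∈ V
  idem : IsIdempotentElem e
  ne_zero : e ≠ 0
  eq_of_idem : ∀ f ∈ V, IsIdempotentElem f → e * f = f → f * e = f → f ≠ 0 → f = e

theorem OrthogonalIdempotents.card_le_finrank (F : Type*) {A : Type*} [Field F] [Ring A]
    [Algebra F A] [FiniteDimensional F A] {ι : Type*} [Fintype ι] {e : ι → A}
    (he : OrthogonalIdempotents e) (h0 : ∀ i, e i ≠ 0) :
    Fintype.card ι ≤ Module.finrank F A := by
  classical
  refine LinearIndependent.fintype_card_le_finrank (b := e) (Fintype.linearIndependent_iff.2 ?_)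
  intro c hc i
  have := congrArg (e i * ·) hc
  simp only [Finset.mul_sum, mul_smul_comm, mul_zero] at this
  rw [Finset.sum_eq_single i (fun j _ hj => by rw [he.ortho hj.symm, smul_zero]) (by simp),
    (he.idem i).eq] at this
  exact (smul_eq_zero.1 this).resolve_right (h0 i)

/-- Split one member of a complete family of orthogonal idempotents. -/
theorem CompleteOrthogonalIdempotents.split {A : Type*} [Ring A] {n : ℕ} {e : Fin n → A}
    (he : CompleteOrthogonalIdempotents e) {i : Fin n} {f : A} (hf : IsIdempotentElem f)
    (hef : e i * f = f) (hfe : f * e i = f) :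
    CompleteOrthogonalIdempotents
      (Fin.cons f (Function.update e i (e i - f)) : Fin (n + 1) → A) := by
  have hef' (j : Fin n) (hj : j ≠ i) : e j * f = 0 := by
    rw [← hef, ← mul_assoc, he.ortho hj, zero_mul]
  have hfe' (j : Fin n) (hj : j ≠ i) : f * e j = 0 := by
    rw [← hfe, mul_assoc, he.ortho hj.symm, mul_zero]
  refine ⟨⟨?_, ?_⟩, ?_⟩
  · refine Fin.cases (by simpa using hf) fun j => ?_
    rcases eq_or_ne j i with rfl | hj
    · simp [IsIdempotentElem, mul_sub, sub_mul, (he.idem j).eq, hf.eq, hef, hfe]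
    · simpa [hj] using he.idem j
  · intro j
    refine Fin.cases ?_ (fun j => ?_) j <;> intro k <;>
      refine Fin.cases ?_ (fun k => ?_) k <;> intro hjk
    · exact absurd rfl hjk
    · rcases eq_or_ne k i with rfl | hk
      · simp [mul_sub, hfe, hf.eq]
      · simp [hk, hfe' k hk]
    · rcases eq_or_ne j i with rfl | hj
      · simp [sub_mul, hef, hf.eq]
      · simp [hj, hef' j hj]
    · have hjk : j ≠ k := fun h => hjk (h ▸ rfl)
      rcases eq_or_ne j i with rfl | hj
      · simp [hjk.symm, sub_mul, he.ortho hjk, hfe' k hjk.symm]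
      · rcases eq_or_ne k i with rfl | hk
        · simp [hj, mul_sub, he.ortho hj, hef' j hj]
        · simpa [hj, hk] using he.ortho hjk
  · rw [Fin.sum_univ_succ]
    simp only [Fin.cons_zero, Fin.cons_succ]
    rw [Finset.sum_update_of_mem (Finset.mem_univ i), ← he.complete,
      ← Finset.add_sum_erase _ e (Finset.mem_univ i), Finset.sdiff_singleton_eq_erase]
    abel

namespace IsGAlgGrading

variable {F G A : Type*} [Field F] [Group G] [Ring A] [Algebra F A] [DecidableEq G]
  {𝒜 : G → Submodule F A}

/-- `1` is a sum of orthogonal idempotents which are primitive in the component of degree one. -/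
theorem exists_primitive_decomposition [FiniteDimensional F A] [Nontrivial A]
    (hA : IsGAlgGrading F 𝒜) : ∃ (n : ℕ) (e : Fin n → A), CompleteOrthogonalIdempotents e ∧
      ∀ i, IsPrimitiveIdempotentIn (𝒜 1) (e i) := by
  let S : Set ℕ := {n | ∃ e : Fin n → A, CompleteOrthogonalIdempotents e ∧
    ∀ i, e i ∈ 𝒜 1 ∧ e i ≠ 0}
  have hS : BddAbove S := by
    refine ⟨Module.finrank F A, ?_⟩
    rintro n ⟨e, he, h⟩
    simpa using he.toOrthogonalIdempotents.card_le_finrank F fun i => (h i).2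
  have hne : S.Nonempty := by
    refine ⟨1, fun _ => 1, ⟨⟨fun _ => IsIdempotentElem.one, ?_⟩, by simp⟩,
      fun _ => ⟨hA.one_mem, one_ne_zero⟩⟩
    exact fun i j hij => absurd (Subsingleton.elim i j) hij
  obtain ⟨e, he, h⟩ := Nat.sSup_mem hne hS
  refine ⟨sSup S, e, he, fun i => ⟨(h i).1, he.idem i, (h i).2, fun f hf hff hef hfe hf0 => ?_⟩⟩
  by_contra hne
  have : sSup S + 1 ∈ S := by
    refine ⟨_, he.split hff hef hfe, Fin.cases (by simpa using ⟨hf, hf0⟩) fun j => ?_⟩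
    rcases eq_or_ne j i with rfl | hj
    · simpa using ⟨sub_mem (h j).1 hf, sub_ne_zero.2 (Ne.symm hne)⟩
    · simpa [hj] using h j
  have := le_csSup hS this
  omega

/-- A nonzero homogeneous element between primitive idempotents is invertible. -/
theorem exists_inverse [CharZero F] [FiniteDimensional F A] (hA : IsGAlgGrading F 𝒜)
    (hs : IsGSimpleAlg F 𝒜) {e e' x : A} {g : G} (he : IsPrimitiveIdempotentIn (𝒜 1) e)
    (he' : IsPrimitiveIdempotentIn (𝒜 1) e') (hx : x ∈ 𝒜 g) (hx0 : x ≠ 0) (hex : e * x = x)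
    (hxe : x * e' = x) : ∃ y ∈ 𝒜 g⁻¹, y * e = y ∧ x * y = e ∧ y * x = e' := by
  obtain ⟨h, k, a, ha, b, hb, hk, hr⟩ := hA.exists_not_isNilpotent hs he.idem he.ne_zero hx hx0
  set r := e * (a * x * b) * e with hrdef
  have hee := he.idem.eq
  have hee' := he'.idem.eq
  have hr1 : r ∈ 𝒜 1 := by
    have := hA.mul_mem (hA.mul_mem he.mem (hA.mul_mem (hA.mul_mem ha hx) hb)) he.mem
    rwa [hk, one_mul, one_mul] at this
  have her : e * r = r := by simp only [hrdef, ← mul_assoc, hee]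
  have hre : r * e = r := by simp only [hrdef, mul_assoc, hee]
  obtain ⟨s, hsr, hcomm, hidem, hrs0⟩ := exists_mul_idempotent_of_not_isNilpotent (F := F) hr
  have hs1 := hA.adjoin_le hr1 hsr
  have hrs : r * s = e := by
    refine he.eq_of_idem _ (by simpa using hA.mul_mem hr1 hs1) hidem ?_ ?_ hrs0
    · rw [← mul_assoc, her]
    · rw [← hcomm, mul_assoc, hre]
  have hkg : k * h = g⁻¹ := by
    rw [eq_inv_iff_mul_eq_one, mul_assoc, mul_eq_one_iff_eq_inv', eq_inv_iff_mul_eq_one]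
    exact hk
  set y := e' * (b * e * s * e * a) * e with hydef
  have hy : y ∈ 𝒜 g⁻¹ := by
    have := hA.mul_mem (hA.mul_mem he'.mem (hA.mul_mem (hA.mul_mem (hA.mul_mem
      (hA.mul_mem hb he.mem) hs1) he.mem) ha)) he.mem
    simpa [hkg] using this
  have hye : y * e = y := by simp only [hydef, mul_assoc, hee]
  have hey : e' * y = y := by simp only [hydef, ← mul_assoc, hee']
  have hxy : x * y = x * (b * e * s * e * a) * e := by
    rw [hydef, ← mul_assoc, ← mul_assoc, hxe]
  have haxb : e * a * (x * b) * e = r := by simp only [hrdef, mul_assoc]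
  have hxyxy : IsIdempotentElem (x * y) := by
    calc x * y * (x * y) = x * b * e * s * (e * a * (e * x * b) * e) * s * e * a * e := by
          rw [hxy]; simp only [mul_assoc]
      _ = x * b * e * (s * r) * s * e * a * e := by rw [hex, haxb]; simp only [mul_assoc]
      _ = x * b * (e * e) * s * e * a * e := by rw [hcomm, hrs]; simp only [mul_assoc]
      _ = x * y := by rw [hee, hxy]; simp only [mul_assoc]
  have hxy0 : x * y ≠ 0 := by
    intro h0
    refine hr ⟨1, ?_⟩
    calc r ^ 1 = e * e * r := by rw [pow_one, hee, her]
      _ = r * s * (r * s) * r := by rw [hrs]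
      _ = r * (s * r) * s * r := by simp only [mul_assoc]
      _ = r * e * s * r := by rw [hcomm, hrs]
      _ = (e * a * (x * b) * e) * s * (e * a * (e * x * b) * e) := by rw [hre, hex, haxb]
      _ = e * a * (x * y) * x * b * e := by rw [hxy]; simp only [mul_assoc]
      _ = 0 := by rw [h0]; simp
  have hxy' : x * y = e := by
    refine he.eq_of_idem _ (by simpa using hA.mul_mem hx hy) hxyxy ?_ ?_ hxy0
    · rw [← mul_assoc, hex]
    · rw [mul_assoc, hye]
  refine ⟨y, hy, hye, hxy', he'.eq_of_idem _ (by simpa using hA.mul_mem hy hx) ?_ ?_ ?_ ?_⟩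
  · rw [IsIdempotentElem, ← mul_assoc, mul_assoc y x y, hxy', hye]
  · rw [← mul_assoc, hey]
  · rw [mul_assoc, hxe]
  · intro h0
    have : x * y * x = 0 := by rw [mul_assoc, h0, mul_zero]
    rw [hxy', hex] at this
    exact hx0 this

/-- Over an algebraically closed field, the degree-one part of the corner at a primitive
idempotent is one-dimensional. -/
theorem exists_eq_smul_idempotent [IsAlgClosed F] [CharZero F] [FiniteDimensional F A]
    (hA : IsGAlgGrading F 𝒜) (hs : IsGSimpleAlg F 𝒜) {e r : A}
    (he : IsPrimitiveIdempotentIn (𝒜 1) e) (hr : r ∈ 𝒜 1) (her : e * r = r) (hre : r * e = r) :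
    ∃ c : F, r = c • e := by
  let V : Submodule F A := LinearMap.range (LinearMap.mulLeft F e)
  have hV (v : A) (hv : v ∈ V) : e * v = v := by
    obtain ⟨w, rfl⟩ := hv
    simp [← mul_assoc, he.idem.eq]
  have heV : e ∈ V := ⟨e, he.idem.eq⟩
  have hmap : ∀ v ∈ V, LinearMap.mulLeft F r v ∈ V := fun v _ =>
    ⟨r * v, by simp [← mul_assoc, her]⟩
  have : Nontrivial V := ⟨⟨e, heV⟩, 0, fun h => he.ne_zero (congrArg Subtype.val h)⟩
  obtain ⟨c, hc⟩ := Module.End.exists_eigenvalue ((LinearMap.mulLeft F r).restrict hmap)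
  obtain ⟨v, hv⟩ := hc.exists_hasEigenvector
  have hrv : r * (v : A) = c • (v : A) := congrArg Subtype.val hv.apply_eq_smul
  refine ⟨c, ?_⟩
  by_contra hne
  obtain ⟨y, -, -, -, hy⟩ := hA.exists_inverse hs he he
    (sub_mem hr ((𝒜 1).smul_mem c he.mem)) (sub_ne_zero.2 hne)
    (by rw [mul_sub, her, mul_smul_comm, he.idem.eq])
    (by rw [sub_mul, hre, smul_mul_assoc, he.idem.eq])
  refine hv.2 (Subtype.ext ?_)
  calc (v : A) = e * v := (hV v v.2).symm
    _ = y * ((r - c • e) * v) := by rw [← mul_assoc, hy]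
    _ = 0 := by rw [sub_mul, hrv, smul_mul_assoc, hV v v.2, sub_self, mul_zero]

/-- The homogeneous components between two primitive idempotents are at most one-dimensional. -/
theorem exists_eq_smul [IsAlgClosed F] [CharZero F] [FiniteDimensional F A]
    (hA : IsGAlgGrading F 𝒜) (hs : IsGSimpleAlg F 𝒜) {e e' x x' : A} {g : G}
    (he : IsPrimitiveIdempotentIn (𝒜 1) e) (he' : IsPrimitiveIdempotentIn (𝒜 1) e')
    (hx : x ∈ 𝒜 g) (hx0 : x ≠ 0) (hex : e * x = x) (hxe : x * e' = x)
    (hx' : x' ∈ 𝒜 g) (hex' : e * x' = x') (hxe' : x' * e' = x') : ∃ c : F, x' = c • x := by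
  obtain ⟨y, hy, hye, -, hyx⟩ := hA.exists_inverse hs he he' hx hx0 hex hxe
  obtain ⟨c, hc⟩ := hA.exists_eq_smul_idempotent hs he (r := x' * y)
    (by simpa using hA.mul_mem hx' hy) (by rw [← mul_assoc, hex']) (by rw [mul_assoc, hye])
  exact ⟨c, by rw [← hxe', ← hyx, ← mul_assoc, hc, smul_mul_assoc, hex]⟩

/-- A homogeneous component has a spanning set of nonzero elements lying in pairwise distinct
corners of a system of orthogonal idempotents. -/
theorem exists_peirce_family [IsAlgClosed F] [CharZero F] [FiniteDimensional F A]
    (hA : IsGAlgGrading F 𝒜) (hs : IsGSimpleAlg F 𝒜) (g : G) :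
    ∃ (n d : ℕ) (e : Fin n → A) (p : Fin d → Fin n × Fin n) (x : Fin d → A),
      OrthogonalIdempotents e ∧ (∀ i, e i ∈ 𝒜 1) ∧ Function.Injective p ∧
      (∀ k, x k ∈ 𝒜 g ∧ x k ≠ 0 ∧ e (p k).1 * x k = x k ∧ x k * e (p k).2 = x k) ∧
      Module.finrank F (𝒜 g) ≤ d := by
  classical
  have : Nontrivial A := ⟨hs.1.choose, 0, hs.1.choose_spec⟩
  obtain ⟨n, e, he, hprim⟩ := hA.exists_primitive_decomposition
  let T := {q : Fin n × Fin n // ∃ a ∈ 𝒜 g, e q.1 * a * e q.2 ≠ 0}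
  choose a ha ha0 using fun q : T => q.2
  let x (q : T) : A := e q.1.1 * a q * e q.1.2
  have hmem (i j : Fin n) (b : A) (hb : b ∈ 𝒜 g) : e i * b * e j ∈ 𝒜 g := by
    simpa using hA.mul_mem (hA.mul_mem (hprim i).mem hb) (hprim j).mem
  have hl (i j : Fin n) (b : A) : e i * (e i * b * e j) = e i * b * e j := by
    simp only [← mul_assoc, (he.idem i).eq]
  have hr (i j : Fin n) (b : A) : e i * b * e j * e j = e i * b * e j := by
    simp only [mul_assoc, (he.idem j).eq]
  have hspan : 𝒜 g ≤ Submodule.span F (Set.range x) := by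
    intro b hb
    have hb' : b = ∑ i, ∑ j, e i * b * e j := by
      simp only [← Finset.mul_sum, ← Finset.sum_mul, he.complete, one_mul, mul_one]
    rw [hb']
    refine Submodule.sum_mem _ fun i _ => Submodule.sum_mem _ fun j _ => ?_
    by_cases h0 : e i * b * e j = 0
    · rw [h0]; exact zero_mem _
    · let q : T := ⟨(i, j), b, hb, h0⟩
      obtain ⟨c, hc⟩ := hA.exists_eq_smul hs (hprim i) (hprim j) (hmem i j _ (ha q)) (ha0 q)
        (hl i j _) (hr i j _) (hmem i j b hb) (hl i j b) (hr i j b)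
      rw [hc]
      exact Submodule.smul_mem _ c (Submodule.subset_span ⟨q, rfl⟩)
  let φ := (Fintype.equivFin T).symm
  refine ⟨n, Fintype.card T, e, fun k => (φ k).1, x ∘ φ, he.toOrthogonalIdempotents,
    fun i => (hprim i).mem, Subtype.val_injective.comp φ.injective,
    fun k => ⟨hmem _ _ _ (ha _), ha0 _, hl _ _ _, hr _ _ _⟩, ?_⟩
  exact (Submodule.finrank_mono hspan).trans (finrank_range_le_card x)

/-- Nonzero homogeneous elements can be interlaced with homogeneous elements so that the product
is nonzero. -/
theorem exists_prod_ne_zero [Nontrivial A] (hA : IsGAlgGrading F 𝒜) (hs : IsGSimpleAlg F 𝒜)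
    {g : G} {d : ℕ} {x : Fin d → A} (hx : ∀ k, x k ∈ 𝒜 g) (hx0 : ∀ k, x k ≠ 0) :
    ∃ (h : Fin d → G) (c : Fin d → A), (∀ k, c k ∈ 𝒜 (h k)) ∧
      ∃ h', (List.ofFn fun k => x k * c k).prod ∈ 𝒜 h' ∧
        (List.ofFn fun k => x k * c k).prod ≠ 0 := by
  induction d with
  | zero => exact ⟨Fin.elim0, Fin.elim0, fun k => k.elim0, 1, by simpa using hA.one_mem, by simp⟩
  | succ d ih =>
    obtain ⟨h, c, hc, h', hm, h0⟩ := ih (fun k => hx k.succ) (fun k => hx0 k.succ)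
    obtain ⟨h₀, c₀, hc₀, hne⟩ := hA.exists_mul_mul_ne_zero hs (hx0 0) hm h0
    refine ⟨Fin.cons h₀ h, Fin.cons c₀ c, Fin.cases (by simpa) (by simpa), g * h₀ * h', ?_, ?_⟩
    · simpa [List.ofFn_succ] using hA.mul_mem (hA.mul_mem (hx 0) hc₀) hm
    · simpa [List.ofFn_succ] using hne

/-- A Capelli polynomial alternating in as many variables of degree `g` as the dimension of the
component of degree `g` does not vanish on a `G`-simple algebra. -/
theorem exists_capelliMap_ne_zero [IsAlgClosed F] [CharZero F] [FiniteDimensional F A]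
    (hA : IsGAlgGrading F 𝒜) (hs : IsGSimpleAlg F 𝒜) (g : G) :
    ∃ (d : ℕ) (h : Fin d → G) (z w x : Fin d → A), Module.finrank F (𝒜 g) ≤ d ∧
      (∀ k, z k ∈ 𝒜 1) ∧ (∀ k, w k ∈ 𝒜 (h k)) ∧ (∀ k, x k ∈ 𝒜 g) ∧ capelliMap F z w x ≠ 0 := by
  have : Nontrivial A := ⟨hs.1.choose, 0, hs.1.choose_spec⟩
  obtain ⟨n, d, e, p, x, he, he1, hp, hx, hd⟩ := hA.exists_peirce_family hs g
  choose hxg hx0 hex hxe using hx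
  obtain ⟨h, c, hc, -, -, hne⟩ := hA.exists_prod_ne_zero hs hxg hx0
  refine ⟨d, h, fun k => e (p k).1, fun k => e (p k).2 * c k, x, hd, fun k => he1 _,
    fun k => by simpa using hA.mul_mem (he1 (p k).2) (hc k), hxg, ?_⟩
  rw [capelliMap_eq_prod]
  · simpa [hex, ← mul_assoc, hxe] using hne
  · intro k l hlk
    by_cases h1 : (p k).1 = (p l).1
    · have h2 : (p l).2 ≠ (p k).2 := fun h2 => hlk (hp (Prod.ext h1.symm h2))
      rw [← hxe l, mul_assoc, mul_assoc (x l), ← mul_assoc _ _ (c k), he.ortho h2]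
      simp
    · rw [← hex l, ← mul_assoc (e _) (e _) (x l), he.ortho h1]
      simp

theorem finrank_component_le [IsAlgClosed F] [CharZero F] [FiniteDimensional F A] {B : Type*}
    [Ring B] [Algebra F B] [FiniteDimensional F B] {ℬ : G → Submodule F B}
    (hA : IsGAlgGrading F 𝒜) (hs : IsGSimpleAlg F 𝒜)
    (hid : ∀ p : FreeAlgebra F (ℕ × G), IsGradedIdentity F ℬ p → IsGradedIdentity F 𝒜 p) (g : G) :
    Module.finrank F (𝒜 g) ≤ Module.finrank F (ℬ g) := by
  obtain ⟨d, h, z, w, x, hd, hz, hw, hx, hne⟩ := hA.exists_capelliMap_ne_zero hs g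
  refine hd.trans (le_of_not_gt fun hlt => ?_)
  let X : ℕ × G → FreeAlgebra F (ℕ × G) := FreeAlgebra.ι F
  let P := capelliMap F (fun k : Fin d => X (3 * k, 1)) (fun k => X (3 * k + 1, h k))
    (fun k => X (3 * k + 2, g))
  have hPB : IsGradedIdentity F ℬ P := fun v hv => by
    rw [map_capelliMap]
    exact capelliMap_eq_zero_of_finrank_lt hlt _ _ fun k => by simpa [X] using hv _ g
  classical
  let v : ℕ × G → A := fun q =>
    if hq : q.1 / 3 < d then
      if q.1 % 3 = 0 ∧ q.2 = 1 then z ⟨q.1 / 3, hq⟩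
      else if q.1 % 3 = 1 ∧ q.2 = h ⟨q.1 / 3, hq⟩ then w ⟨q.1 / 3, hq⟩
      else if q.1 % 3 = 2 ∧ q.2 = g then x ⟨q.1 / 3, hq⟩ else 0
    else 0
  have hv (i : ℕ) (l : G) : v (i, l) ∈ 𝒜 l := by
    dsimp only [v]
    split_ifs with h1 h2 h3 h4
    · exact h2.2 ▸ hz _
    · exact h3.2 ▸ hw _
    · exact h4.2 ▸ hx _
    · exact zero_mem _
    · exact zero_mem _
  have hvz (k : Fin d) : v (3 * k, 1) = z k := by simp [v]
  have hvw (k : Fin d) : v (3 * k + 1, h k) = w k := by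
    have : (3 * (k : ℕ) + 1) / 3 = k := by omega
    simp [v, this, Nat.add_mod]
  have hvx (k : Fin d) : v (3 * k + 2, g) = x k := by
    have : (3 * (k : ℕ) + 2) / 3 = k := by omega
    simp [v, this, Nat.add_mod]
  have := hid P hPB v hv
  rw [map_capelliMap] at this
  refine hne ?_
  rw [← this]
  congr <;> funext k <;> simp [X, hvz, hvw, hvx]

theorem finrank_eq_of_forall [FiniteDimensional F A] {B : Type*} [Ring B] [Algebra F B]
    [FiniteDimensional F B] {ℬ : G → Submodule F B} (hA : IsGAlgGrading F 𝒜)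
    (hB : IsGAlgGrading F ℬ) (h : ∀ g, Module.finrank F (𝒜 g) = Module.finrank F (ℬ g)) :
    Module.finrank F A = Module.finrank F B :=
  let _ := hA.isInternal.chooseDecomposition
  let _ := hB.isInternal.chooseDecomposition
  ((DirectSum.decomposeLinearEquiv 𝒜).trans
    ((DFinsupp.mapRange.linearEquiv fun g => LinearEquiv.ofFinrankEq (𝒜 g) (ℬ g) (h g)).trans
      (DirectSum.decomposeLinearEquiv ℬ).symm)).finrank_eq

end IsGAlgGrading

/-- If `A` is a finite-dimensional `G`-simple graded algebra and `B` a finite-dimensional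
graded algebra over an algebraically closed field of characteristic zero with
`Id_G(B) ⊆ Id_G(A)`, then `dim_F A_g ≤ dim_F B_g` for every `g`.  Consequently, if `B` is
also `G`-simple and `Id_G(A) = Id_G(B)`, then `dim_F A_g = dim_F B_g` for every `g`, and
in particular `dim_F A = dim_F B`. -/
theorem finrank_le_of_gradedIdentities_subset
    {G : Type*} [Group G] [DecidableEq G]
    (F : Type*) [Field F] [IsAlgClosed F] [CharZero F]
    {A B : Type*} [Ring A] [Algebra F A] [Ring B] [Algebra F B]
    [FiniteDimensional F A] [FiniteDimensional F B]
    (𝒜 : G → Submodule F A) (ℬ : G → Submodule F B)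
    (hA : IsGAlgGrading F 𝒜) (hB : IsGAlgGrading F ℬ)
    (hAs : IsGSimpleAlg F 𝒜) :
    ((∀ p : FreeAlgebra F (ℕ × G), IsGradedIdentity F ℬ p → IsGradedIdentity F 𝒜 p) →
      ∀ g : G, Module.finrank F (𝒜 g) ≤ Module.finrank F (ℬ g)) ∧
    (IsGSimpleAlg F ℬ →
      (∀ p : FreeAlgebra F (ℕ × G), IsGradedIdentity F 𝒜 p ↔ IsGradedIdentity F ℬ p) →
      (∀ g : G, Module.finrank F (𝒜 g) = Module.finrank F (ℬ g)) ∧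
      Module.finrank F A = Module.finrank F B) := by
  refine ⟨hA.finrank_component_le hAs, fun hBs hid => ?_⟩
  have h (g : G) : Module.finrank F (𝒜 g) = Module.finrank F (ℬ g) :=
    le_antisymm (hA.finrank_component_le hAs (fun p => (hid p).2) g)
      (hB.finrank_component_le hBs (fun p => (hid p).1) g)
  exact ⟨h, hA.finrank_eq_of_forall hB h⟩
end
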